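/- Let q ≥ 0 be an integer and let d = 7·2^q − 4. Given 2^{q+1} − 1 masses μ_1, …, μ_{2^{q+1}−1} on ℝ^d, there exist four hyperplanes H_1, H_2, H_3, H_4 in ℝ^d such that each of the first 2^{q+1} − 2 masses μ_1, …, μ_{2^{q+1}−2} is equipartitioned by any three of the four hyperplanes, and the remaining mass μ_{2^{q+1}−1} is equipartitioned by the triple H_2, H_3, H_4. -/

import Mathlib

open MeasureTheory RealInnerProductSpace

noncomputable section

/-- The closed half-space determined by the hyperplane `{x | ⟪a, x⟫ = b}`:
`true` corresponds to `H⁺ = {x | ⟪a, x⟫ ≥ b}`, `false` to `H⁻ = {x | ⟪a, x⟫ ≤ b}`. -/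
def halfSpace {d : ℕ} (a : EuclideanSpace ℝ (Fin d)) (b : ℝ) (ε : Bool) :
    Set (EuclideanSpace ℝ (Fin d)) :=
  if ε then {x | b ≤ ⟪a, x⟫} else {x | ⟪a, x⟫ ≤ b}

/-- The region `⋂ i ∈ s, H i ^ (ε i)` determined by the hyperplanes indexed by `s`. -/
def region {d k : ℕ} (a : Fin k → EuclideanSpace ℝ (Fin d)) (b : Fin k → ℝ)
    (s : Finset (Fin k)) (ε : Fin k → Bool) : Set (EuclideanSpace ℝ (Fin d)) :=
  ⋂ i ∈ s, halfSpace (a i) (b i) (ε i)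

section PartA
open Finset

set_option linter.unusedSectionVars false
set_option linter.unusedVariables false

namespace BU

/-- even endpoint of the unit interval `[n, n+1]` -/
def ev (n : ℕ) : ℕ := if n % 2 = 0 then n else n + 1
/-- odd endpoint of the unit interval `[n, n+1]` -/
def od (n : ℕ) : ℕ := if n % 2 = 0 then n + 1 else n

/-- `l`-th vertex of the simplex indexed by the cube `p` and the ordering `e`. -/
def V {ι : Type} {m : ℕ} (e : Fin m ≃ ι) (p : ι → ℕ) (l : ℕ) : ι → ℕ :=
  fun i => if (e.symm i : ℕ) < l then od (p i) else ev (p i)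

variable {ι : Type} [Fintype ι] [DecidableEq ι]

/-- index set of simplices -/
def Sx (ι : Type) [Fintype ι] [DecidableEq ι] (T m : ℕ) : Finset ((ι → ℕ) × (Fin m ≃ ι)) :=
  (Fintype.piFinset fun _ : ι => Finset.range T) ×ˢ Finset.univ

/-- difference of `s` along two vertices -/
def Df (s : (ι → ℕ) → ZMod 2) {m : ℕ} (x : (ι → ℕ) × (Fin m ≃ ι)) (a b : ℕ) : ZMod 2 :=
  s (V x.2 x.1 a) + s (V x.2 x.1 b)

def Phi (T m : ℕ) (s : ℕ → (ι → ℕ) → ZMod 2) : ZMod 2 :=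
  ∑ x ∈ Sx ι T m, ∏ j ∈ range m, Df (s j) x j (j + 1)

/-- flip across the first vertex -/
def flipN (n : ℕ) : ℕ := if n % 2 = 0 then n + 1 else n - 1
def flipE (n : ℕ) : ℕ := if n % 2 = 0 then n - 1 else n + 1

lemma z2_add_self (a : ZMod 2) : a + a = 0 := by
  revert a; decide

lemma V_upd_first {m : ℕ} (e : Fin (m+1) ≃ ι) (p : ι → ℕ) (l : ℕ) (hl : 1 ≤ l) :
    V e (Function.update p (e 0) (flipN (p (e 0)))) l = V e p l := by
  funext i
  by_cases hi : i = e 0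
  · subst hi
    simp only [V, Equiv.symm_apply_apply, Function.update_self]
    have : ((0 : Fin (m+1)) : ℕ) < l := by simpa using (by omega : 0 < l)
    rw [if_pos this, if_pos this]
    unfold od flipN; split_ifs <;> omega
  · simp [V, Function.update_of_ne hi]

lemma V_upd_last {m : ℕ} (e : Fin (m+1) ≃ ι) (p : ι → ℕ) (l : ℕ) (hl : l ≤ m)
    (h0 : p (e (Fin.last m)) ≠ 0) :
    V e (Function.update p (e (Fin.last m)) (flipE (p (e (Fin.last m))))) l = V e p l := by
  funext i
  by_cases hi : i = e (Fin.last m)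
  · subst hi
    simp only [V, Equiv.symm_apply_apply, Function.update_self]
    have : ¬ ((Fin.last m : Fin (m+1)) : ℕ) < l := by simpa using hl
    rw [if_neg this, if_neg this]
    unfold ev flipE; split_ifs <;> omega
  · simp [V, Function.update_of_ne hi]

lemma V_swap {m : ℕ} (e : Fin m ≃ ι) (p : ι → ℕ) (k : ℕ) (hk : k + 1 < m) (l : ℕ)
    (hl : l ≠ k + 1) :
    V ((Equiv.swap (⟨k, by omega⟩ : Fin m) ⟨k+1, hk⟩).trans e) p l = V e p l := by
  funext i
  simp only [V, Equiv.symm_trans_apply, Equiv.symm_swap]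
  have key : ∀ a : Fin m, ((Equiv.swap (⟨k, by omega⟩ : Fin m) ⟨k+1, hk⟩ a : Fin m) : ℕ) < l ↔ (a : ℕ) < l := by
    intro a
    rcases eq_or_ne a ⟨k, by omega⟩ with rfl | h1
    · rw [Equiv.swap_apply_left]; simp; omega
    · rcases eq_or_ne a ⟨k+1, hk⟩ with rfl | h2
      · rw [Equiv.swap_apply_right]; simp; omega
      · rw [Equiv.swap_apply_of_ne_of_ne h1 h2]
  simp only [key]

lemma sum_first (T m : ℕ) (hT : T % 2 = 0) (F : (ι → ℕ) × (Fin (m+1) ≃ ι) → ZMod 2)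
    (hF : ∀ p e, F (Function.update p (e 0) (flipN (p (e 0))), e) = F (p, e)) :
    ∑ x ∈ Sx ι T (m+1), F x = 0 := by
  refine Finset.sum_involution
    (fun x _ => (Function.update x.1 (x.2 0) (flipN (x.1 (x.2 0))), x.2)) ?_ ?_ ?_ ?_
  · rintro ⟨p, e⟩ _; simp only [hF]; exact z2_add_self _
  · rintro ⟨p, e⟩ _ _ h
    have := congrFun (congrArg Prod.fst h) (e 0)
    simp only [Function.update_self] at this
    unfold flipN at this; split_ifs at this <;> omega
  · rintro ⟨p, e⟩ h
    simp only [Sx, mem_product, Fintype.mem_piFinset, Finset.mem_range, mem_univ, and_true] at h ⊢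
    intro i
    by_cases hi : i = e 0
    · subst hi; have := h (e 0); simp only [Function.update_self]; unfold flipN; split_ifs <;> omega
    · rw [Function.update_of_ne hi]; exact h i
  · rintro ⟨p, e⟩ _
    simp only [Function.update_self, Function.update_idem, Prod.mk.injEq, and_true]
    have : flipN (flipN (p (e 0))) = p (e 0) := by unfold flipN; split_ifs <;> omega
    rw [this, Function.update_eq_self]

lemma sum_mid (T m k : ℕ) (hk : k + 1 < m) (F : (ι → ℕ) × (Fin m ≃ ι) → ZMod 2)
    (hF : ∀ p e, F (p, (Equiv.swap (⟨k, by omega⟩ : Fin m) ⟨k+1, hk⟩).trans e) = F (p, e)) :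
    ∑ x ∈ Sx ι T m, F x = 0 := by
  refine Finset.sum_involution
    (fun x _ => (x.1, (Equiv.swap (⟨k, by omega⟩ : Fin m) ⟨k+1, hk⟩).trans x.2)) ?_ ?_ ?_ ?_
  · rintro ⟨p, e⟩ _; simp only [hF]; exact z2_add_self _
  · rintro ⟨p, e⟩ _ _ h
    have := congrArg (fun e : Fin m ≃ ι => e ⟨k, by omega⟩) (congrArg Prod.snd h)
    simp at this
  · rintro ⟨p, e⟩ h
    simpa [Sx] using h
  · rintro ⟨p, e⟩ _
    simp only [Prod.mk.injEq, true_and]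
    ext a; simp

lemma sum_last (T m : ℕ) (hT : T % 2 = 0) (F : (ι → ℕ) × (Fin (m+1) ≃ ι) → ZMod 2)
    (hF : ∀ p e, p (e (Fin.last m)) ≠ 0 →
      F (Function.update p (e (Fin.last m)) (flipE (p (e (Fin.last m)))), e) = F (p, e)) :
    ∑ x ∈ Sx ι T (m+1), F x = ∑ x ∈ (Sx ι T (m+1)).filter
      (fun x => x.1 (x.2 (Fin.last m)) = 0 ∨ x.1 (x.2 (Fin.last m)) = T - 1), F x := by
  rw [← Finset.sum_filter_add_sum_filter_not (Sx ι T (m+1))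
    (fun x => x.1 (x.2 (Fin.last m)) = 0 ∨ x.1 (x.2 (Fin.last m)) = T - 1)]
  rw [add_eq_left]
  refine Finset.sum_involution
    (fun x _ => (Function.update x.1 (x.2 (Fin.last m)) (flipE (x.1 (x.2 (Fin.last m)))), x.2))
    ?_ ?_ ?_ ?_
  · rintro ⟨p, e⟩ h
    simp only [mem_filter, not_or] at h
    simp only [hF p e h.2.1]; exact z2_add_self _
  · rintro ⟨p, e⟩ h _ h
    have := congrFun (congrArg Prod.fst h) (e (Fin.last m))
    simp only [mem_filter, not_or] at *
    simp only [Function.update_self] at this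
    unfold flipE at this; split_ifs at this <;> omega
  · rintro ⟨p, e⟩ h
    simp only [Sx, mem_filter, mem_product, Fintype.mem_piFinset, Finset.mem_range, mem_univ, and_true, not_or] at h ⊢
    have h1 := h.1 (e (Fin.last m))
    have h2 := h.2
    refine ⟨?_, ?_⟩
    · intro i
      by_cases hi : i = e (Fin.last m)
      · subst hi; simp only [Function.update_self]; unfold flipE; split_ifs <;> omega
      · rw [Function.update_of_ne hi]; exact h.1 i
    · simp only [Function.update_self]; unfold flipE; split_ifs with hc; (· omega); (· refine ⟨id, ?_⟩; omega)
  · rintro ⟨p, e⟩ h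
    simp only [mem_filter, not_or] at h
    simp only [Function.update_self, Function.update_idem, Prod.mk.injEq, and_true]
    have : flipE (flipE (p (e (Fin.last m)))) = p (e (Fin.last m)) := by
      unfold flipE; split_ifs <;> omega
    rw [this, Function.update_eq_self]

/-- main telescoping -/
lemma Phi_boundary (T m : ℕ) (hT : T % 2 = 0) (s : ℕ → (ι → ℕ) → ZMod 2) :
    Phi T (m+1) s = ∑ x ∈ (Sx ι T (m+1)).filter
      (fun x => x.1 (x.2 (Fin.last m)) = 0 ∨ x.1 (x.2 (Fin.last m)) = T - 1),
      s 0 (V x.2 x.1 0) * ∏ j ∈ range m, Df (s (j+1)) x j (j+1) := by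
  have hB : ∀ k ≤ m, Phi T (m+1) s = ∑ x ∈ Sx ι T (m+1), s 0 (V x.2 x.1 0) *
      ((∏ j ∈ range k, Df (s (j+1)) x j (j+1)) *
        ∏ j ∈ Finset.Ico k m, Df (s (j+1)) x (j+1) (j+2)) := by
    intro k
    induction k with
    | zero =>
      intro _
      have h1 : Phi T (m+1) s = ∑ x ∈ Sx ι T (m+1), s 0 (V x.2 x.1 0) *
          (∏ j ∈ range m, Df (s (j+1)) x (j+1) (j+2)) + ∑ x ∈ Sx ι T (m+1), s 0 (V x.2 x.1 1) *
          (∏ j ∈ range m, Df (s (j+1)) x (j+1) (j+2)) := by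
        rw [← Finset.sum_add_distrib]
        unfold Phi
        refine Finset.sum_congr rfl fun x _ => ?_
        rw [Finset.prod_range_succ', mul_comm, ← add_mul]
        simp only [Df]
      rw [h1, sum_first T m hT (fun x => s 0 (V x.2 x.1 1) *
          (∏ j ∈ range m, Df (s (j+1)) x (j+1) (j+2))), add_zero]
      · simp only [Finset.prod_range_zero, one_mul, Nat.Ico_zero_eq_range]
      · intro p e
        simp only [Df]
        rw [V_upd_first _ _ _ le_rfl]
        congr 1
        refine Finset.prod_congr rfl fun j _ => ?_
        rw [V_upd_first _ _ _ (by omega), V_upd_first _ _ _ (by omega)]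
    | succ k ih =>
      intro hk
      rw [ih (by omega)]
      have := sum_mid (ι := ι) T (m+1) k (by omega) (fun x => s 0 (V x.2 x.1 0) *
        ((∏ j ∈ range k, Df (s (j+1)) x j (j+1)) * (Df (s (k+1)) x k (k+2) *
        ∏ j ∈ Finset.Ico (k+1) m, Df (s (j+1)) x (j+1) (j+2)))) ?_
      · rw [← sub_eq_zero, ← Finset.sum_sub_distrib, ← this]
        refine Finset.sum_congr rfl fun x _ => ?_
        rw [Finset.prod_range_succ, Finset.prod_eq_prod_Ico_succ_bot (by omega : k < m)]
        have : Df (s (k+1)) x k (k+2) = Df (s (k+1)) x (k+1) (k+2) - Df (s (k+1)) x k (k+1) := by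
          simp only [Df]
          generalize s (k+1) (V x.2 x.1 k) = a
          generalize s (k+1) (V x.2 x.1 (k+1)) = b
          generalize s (k+1) (V x.2 x.1 (k+2)) = c
          revert a b c; decide
        rw [this]; ring
      · intro p e
        simp only [Df]
        rw [V_swap _ _ _ _ 0 (by omega), V_swap _ _ _ _ k (by omega),
          V_swap _ _ _ _ (k+2) (by omega)]
        congr 2
        · refine Finset.prod_congr rfl fun j hj => ?_
          rw [Finset.mem_range] at hj
          rw [V_swap _ _ _ _ _ (by omega), V_swap _ _ _ _ _ (by omega)]
        congr 1
        · refine Finset.prod_congr rfl fun j hj => ?_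
          rw [Finset.mem_Ico] at hj
          rw [V_swap _ _ _ _ _ (by omega), V_swap _ _ _ _ _ (by omega)]
  rw [hB m le_rfl]
  simp only [Finset.Ico_self, Finset.prod_empty, mul_one]
  apply sum_last T m hT
  intro p e h0
  simp only [Df]
  rw [V_upd_last _ _ _ (by omega) h0]
  congr 1
  refine Finset.prod_congr rfl fun j hj => ?_
  rw [Finset.mem_range] at hj
  rw [V_upd_last _ _ _ (by omega) h0, V_upd_last _ _ _ (by omega) h0]

end BU

namespace BU

variable {ι : Type} [Fintype ι] [DecidableEq ι]

def ext (i : ι) (b : ℕ) (y : {x // x ≠ i} → ℕ) : ι → ℕ :=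
  fun x => if h : x = i then b else y ⟨x, h⟩

def glue {m : ℕ} (i : ι) (e : Fin m ≃ {x // x ≠ i}) : Fin (m+1) ≃ ι :=
  finSuccEquivLast.trans ((Equiv.optionSubtype i).symm e).1

lemma glue_last {m : ℕ} (i : ι) (e : Fin m ≃ {x // x ≠ i}) : glue i e (Fin.last m) = i := by
  simp [glue]

lemma glue_castSucc {m : ℕ} (i : ι) (e : Fin m ≃ {x // x ≠ i}) (k : Fin m) :
    glue i e k.castSucc = e k := by
  simp [glue]

lemma glue_symm {m : ℕ} (i : ι) (e : Fin m ≃ {x // x ≠ i}) (x : {x // x ≠ i}) :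
    (glue i e).symm x = (e.symm x).castSucc := by
  rw [Equiv.symm_apply_eq, glue_castSucc]; simp

lemma glue_inj {m : ℕ} (i : ι) (e e' : Fin m ≃ {x // x ≠ i}) (h : glue i e = glue i e') :
    e = e' := by
  ext k
  rw [← glue_castSucc, ← glue_castSucc, h]

lemma glue_surj {m : ℕ} (i : ι) (e : Fin (m+1) ≃ ι) (h : e (Fin.last m) = i) :
    ∃ e', glue i e' = e := by
  have hn : (finSuccEquivLast.symm.trans e) none = i := by simpa using h
  refine ⟨Equiv.optionSubtype i ⟨finSuccEquivLast.symm.trans e, hn⟩, ?_⟩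
  unfold glue
  rw [Equiv.symm_apply_apply]
  ext k; simp

lemma V_glue {m : ℕ} (i : ι) (b : ℕ) (e : Fin m ≃ {x // x ≠ i}) (p : {x // x ≠ i} → ℕ) (l : ℕ)
    (hl : l ≤ m) : V (glue i e) (ext i b p) l = ext i (ev b) (V e p l) := by
  funext x
  by_cases hx : x = i
  · subst hx
    have : (glue x e).symm x = Fin.last m := by
      rw [Equiv.symm_apply_eq, glue_last]
    simp only [V, this, ext, dif_pos]
    rw [if_neg (by simpa using hl)]
  · have := glue_symm i e ⟨x, hx⟩
    simp only at this
    simp only [V, this, ext, dif_neg hx, Fin.val_castSucc]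

lemma sum_facet (T m : ℕ) (i : ι) (b : ℕ) (hb : b < T)
    (G : (ι → ℕ) × (Fin (m+1) ≃ ι) → ZMod 2) :
    ∑ x ∈ (Sx ι T (m+1)).filter (fun x => x.2 (Fin.last m) = i ∧ x.1 i = b), G x
      = ∑ y ∈ Sx {x // x ≠ i} T m, G (ext i b y.1, glue i y.2) := by
  symm
  refine Finset.sum_bij (fun y _ => (ext i b y.1, glue i y.2)) ?_ ?_ ?_ ?_
  · rintro ⟨p, e⟩ h
    simp only [Sx, mem_filter, mem_product, Fintype.mem_piFinset, Finset.mem_range, mem_univ,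
      and_true] at h ⊢
    refine ⟨?_, glue_last i e, by simp [ext]⟩
    intro x
    by_cases hx : x = i
    · simp [ext, hx, hb]
    · simp [ext, hx, h]
  · rintro ⟨p, e⟩ _ ⟨p', e'⟩ _ h
    simp only [Prod.mk.injEq] at h ⊢
    refine ⟨?_, glue_inj i _ _ h.2⟩
    funext x
    have := congrFun h.1 x.1
    simpa [ext, x.2] using this
  · rintro ⟨p, e⟩ h
    simp only [Sx, mem_filter, mem_product, Fintype.mem_piFinset, Finset.mem_range, mem_univ,
      and_true] at h
    obtain ⟨e', he⟩ := glue_surj i e h.2.1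
    refine ⟨(fun x => p x, e'), ?_, ?_⟩
    · simp only [Sx, mem_product, Fintype.mem_piFinset, Finset.mem_range, mem_univ, and_true]
      exact fun x => h.1 x
    · simp only [he, Prod.mk.injEq, and_true]
      funext x
      by_cases hx : x = i
      · subst hx; simp [ext, h.2.2]
      · simp [ext, hx]
  · intros; rfl

/-- facet contribution -/
def Psi (T m : ℕ) (s : ℕ → (ι → ℕ) → ZMod 2) (i : ι) (b : ℕ) : ZMod 2 :=
  ∑ y ∈ Sx {x // x ≠ i} T m, s 0 (ext i b (V y.2 y.1 0)) *
    ∏ j ∈ range m, Df (fun z => s (j+1) (ext i b z)) y j (j+1)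

lemma Phi_facets (T m : ℕ) (hT : T % 2 = 0) (hT0 : 0 < T) (s : ℕ → (ι → ℕ) → ZMod 2) :
    Phi T (m+1) s = ∑ i, (Psi T m s i 0 + Psi T m s i T) := by
  rw [Phi_boundary T m hT, ← Finset.sum_fiberwise _ (fun x => x.2 (Fin.last m))]
  refine Finset.sum_congr rfl fun i _ => ?_
  have key : ∀ b < T, ∑ x ∈ (Sx ι T (m+1)).filter (fun x => x.2 (Fin.last m) = i ∧ x.1 i = b),
      (s 0 (V x.2 x.1 0) * ∏ j ∈ range m, Df (s (j+1)) x j (j+1)) = Psi T m s i (ev b) := by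
    intro b hb
    rw [sum_facet T m i b hb]
    unfold Psi
    refine Finset.sum_congr rfl fun y _ => ?_
    simp only [Df]
    rw [V_glue _ _ _ _ _ (by omega)]
    congr 1
    refine Finset.prod_congr rfl fun j hj => ?_
    rw [Finset.mem_range] at hj
    rw [V_glue _ _ _ _ _ (by omega), V_glue _ _ _ _ _ (by omega)]
  have h0 := key 0 hT0
  have h1 := key (T-1) (by omega)
  have e0 : ev 0 = 0 := rfl
  have e1 : ev (T-1) = T := by unfold ev; rw [if_neg (by omega)]; omega
  rw [e0] at h0
  rw [e1] at h1
  rw [← h0, ← h1, ← Finset.sum_union]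
  · refine Finset.sum_congr ?_ fun _ _ => rfl
    ext x
    simp only [mem_filter, mem_union]
    constructor
    · rintro ⟨⟨h, h'⟩, rfl⟩; tauto
    · rintro (⟨h, rfl, h'⟩ | ⟨h, rfl, h'⟩) <;> tauto
  · rw [Finset.disjoint_left]
    intro x hx hx'
    simp only [mem_filter] at hx hx'
    omega

variable {κ : Type} [DecidableEq κ]

/-- flipping a block -/
def bflip (T : ℕ) (blk : ι → κ) (c : κ) (x : ι → ℕ) : ι → ℕ :=
  fun i => if blk i = c then T - x i else x i

/-- Symmetry hypotheses of discrete sign functions. -/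
structure Sym (T : ℕ) (blk : ι → κ) (rk : ι → ℕ) (s : (ι → ℕ) → ZMod 2) (χ : κ → ZMod 2) :
    Prop where
  deg : ∀ x i i' y, (x i = 0 ∨ x i = T) → blk i' = blk i → rk i' < rk i →
    s (Function.update x i' y) = s x
  flip : ∀ x i, (∀ i', x i' ≤ T) → (∀ i', blk i' = blk i → rk i ≤ rk i') → x i = 0 →
    s (bflip T blk (blk i) x) = s x + χ (blk i)

lemma V_le {m : ℕ} (T : ℕ) (hT : T % 2 = 0) (e : Fin m ≃ ι) (p : ι → ℕ) (hp : ∀ i, p i < T)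
    (l : ℕ) (i : ι) : V e p l i ≤ T := by
  have := hp i
  unfold V ev od; split_ifs <;> omega

lemma Psi_deg (T m : ℕ) (hT : T % 2 = 0) (blk : ι → κ) (rk : ι → ℕ) (s : ℕ → (ι → ℕ) → ZMod 2)
    (χ : ℕ → κ → ZMod 2) (hs : ∀ j, Sym T blk rk (s j) (χ j)) (i i' : ι) (hb : blk i' = blk i)
    (hr : rk i' < rk i) (b : ℕ) (hb0 : b = 0 ∨ b = T) : Psi T m s i b = 0 := by
  unfold Psi
  refine Finset.sum_eq_zero fun y _ => ?_
  have hne : i' ≠ i := by rintro rfl; omega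
  refine mul_eq_zero_of_right _ (Finset.prod_eq_zero
    (i := ((y.2.symm ⟨i', hne⟩ : Fin m) : ℕ)) (Finset.mem_range.2 (Fin.is_lt _)) ?_)
  set l : Fin m := y.2.symm ⟨i', hne⟩ with hl
  have : ext i b (V y.2 y.1 (l+1)) =
      Function.update (ext i b (V y.2 y.1 l)) i' (ext i b (V y.2 y.1 (l+1)) i') := by
    funext x
    by_cases hx : x = i'
    · subst hx; simp
    · rw [Function.update_of_ne hx]
      by_cases hx' : x = i
      · simp [ext, hx']
      · simp only [ext, hx', dif_neg, not_false_eq_true, V]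
        have : ((y.2.symm ⟨x, hx'⟩ : Fin m) : ℕ) ≠ l := by
          intro h
          have h2 := Fin.ext h
          rw [hl] at h2
          have := y.2.symm.injective h2
          exact hx (congrArg Subtype.val this)
        have h3 : ((y.2.symm ⟨x, hx'⟩ : Fin m) : ℕ) < l + 1 ↔
          ((y.2.symm ⟨x, hx'⟩ : Fin m) : ℕ) < l := by omega
        simp only [h3]
  simp only [Df]
  rw [this, (hs _).deg _ i i' _ (by simpa [ext] using hb0) hb hr]
  exact z2_add_self _

lemma Psi_flip (T m : ℕ) (hT : T % 2 = 0) (blk : ι → κ) (rk : ι → ℕ) (s : ℕ → (ι → ℕ) → ZMod 2)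
    (χ : ℕ → κ → ZMod 2) (hs : ∀ j, Sym T blk rk (s j) (χ j)) (i : ι)
    (hi : ∀ i', blk i' = blk i → rk i ≤ rk i') :
    Psi T m s i 0 + Psi T m s i T =
      χ 0 (blk i) * Phi T m (fun j (z : {x // x ≠ i} → ℕ) => s (j+1) (ext i 0 z)) := by
  have h1 : Psi T m s i T = ∑ y ∈ Sx {x // x ≠ i} T m,
      (s 0 (ext i 0 (V y.2 y.1 0)) + χ 0 (blk i)) *
        ∏ j ∈ range m, Df (fun z => s (j+1) (ext i 0 z)) y j (j+1) := by
    have hVf : ∀ (p : {x // x ≠ i} → ℕ) (e : Fin m ≃ {x // x ≠ i}) (l : ℕ), (∀ x, p x < T) →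
        ext i T (V e (fun x => if blk x.1 = blk i then T - 1 - p x else p x) l) =
        bflip T blk (blk i) (ext i 0 (V e p l)) := by
      intro p e l hp
      funext x
      by_cases hx : x = i
      · simp [ext, hx, bflip]
      · by_cases hb : blk x = blk i
        · have := hp ⟨x, hx⟩
          simp only [ext, hx, bflip, V, hb, dif_neg, not_false_eq_true, if_true]
          unfold ev od; split_ifs <;> omega
        · simp [ext, hx, bflip, V, hb]
    unfold Psi
    symm
    refine Finset.sum_nbij' (fun y => (fun x => if blk x.1 = blk i then T - 1 - y.1 x else y.1 x, y.2))
      (fun y => (fun x => if blk x.1 = blk i then T - 1 - y.1 x else y.1 x, y.2)) ?_ ?_ ?_ ?_ ?_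
    · rintro ⟨p, e⟩ h
      simp only [Sx, mem_product, Fintype.mem_piFinset, Finset.mem_range, mem_univ,
        and_true] at h ⊢
      intro x; have := h x; split_ifs <;> omega
    · rintro ⟨p, e⟩ h
      simp only [Sx, mem_product, Fintype.mem_piFinset, Finset.mem_range, mem_univ,
        and_true] at h ⊢
      intro x; have := h x; split_ifs <;> omega
    · rintro ⟨p, e⟩ h
      simp only [Sx, mem_product, Fintype.mem_piFinset, Finset.mem_range, mem_univ,
        and_true] at h
      simp only [Prod.mk.injEq, and_true]
      funext x; have := h x; split_ifs <;> omega
    · rintro ⟨p, e⟩ h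
      simp only [Sx, mem_product, Fintype.mem_piFinset, Finset.mem_range, mem_univ,
        and_true] at h
      simp only [Prod.mk.injEq, and_true]
      funext x; have := h x; split_ifs <;> omega
    · rintro ⟨p, e⟩ h
      simp only [Sx, mem_product, Fintype.mem_piFinset, Finset.mem_range, mem_univ,
        and_true] at h
      have hfl : ∀ j l, s j (bflip T blk (blk i) (ext i 0 (V e p l))) =
          s j (ext i 0 (V e p l)) + χ j (blk i) := by
        intro j l
        refine (hs j).flip _ i ?_ hi (by simp [ext])
        intro x
        by_cases hx : x = i
        · simp [ext, hx]
        · simp only [ext, hx, dif_neg, not_false_eq_true]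
          exact V_le T hT e p h l _
      simp only [Df, hVf p e _ h, hfl]
      congr 1
      refine Finset.prod_congr rfl fun j _ => ?_
      generalize χ (j+1) (blk i) = a
      generalize s (j+1) (ext i 0 (V e p j)) = b
      generalize s (j+1) (ext i 0 (V e p (j+1))) = c
      revert a b c; decide
  rw [h1]
  unfold Psi Phi
  rw [Finset.mul_sum, ← Finset.sum_add_distrib]
  refine Finset.sum_congr rfl fun y _ => ?_
  rw [← add_mul, ← add_assoc, z2_add_self, zero_add]

open MvPolynomial in
/-- Discrete Borsuk-Ulam theorem for products of spheres. -/
theorem Phi_eq [Fintype κ] (T : ℕ) (hT : T % 2 = 0) (hT0 : 0 < T) : ∀ (m : ℕ) (ι : Type) [Fintype ι] [DecidableEq ι]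
    (blk : ι → κ) (rk : ι → ℕ)
    (hrk : ∀ i i', blk i = blk i' → rk i = rk i' → i = i')
    (hm : Fintype.card ι = m)
    (s : ℕ → (ι → ℕ) → ZMod 2) (χ : ℕ → κ → ZMod 2) (hs : ∀ j, Sym T blk rk (s j) (χ j))
    (n : κ →₀ ℕ) (hn : ∀ c, n c = Fintype.card {i // blk i = c}),
    Phi T m s = coeff n (∏ j ∈ range m, ∑ c, MvPolynomial.C (χ j c) * X c) := by
  intro m
  induction m with
  | zero =>
    intro ι _ _ blk rk hrk hm s χ hs n hn
    have : IsEmpty ι := Fintype.card_eq_zero_iff.1 hm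
    have hn0 : n = 0 := by ext c; simp [hn]
    subst hn0
    simp only [Phi, Finset.prod_range_zero, Finset.sum_const, coeff_zero_one]
    have : (Sx ι T 0).card = 1 := by
      simp only [Sx, card_product, Fintype.card_piFinset, Finset.univ_eq_empty, Finset.prod_empty, one_mul, Finset.card_univ]
      rw [Fintype.card_eq_one_iff]
      exact ⟨Equiv.equivOfIsEmpty _ _, fun y => by ext x; exact x.elim0⟩
    simp [this]
  | succ m ih =>
    intro ι _ _ blk rk hrk hm s χ hs n hn
    rw [Phi_facets T m hT hT0, Finset.prod_range_succ', mul_comm, Finset.sum_mul, coeff_sum]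
    have hstep : ∀ i, (∀ i', blk i' = blk i → rk i ≤ rk i') →
        Psi T m s i 0 + Psi T m s i T = coeff n (MvPolynomial.C (χ 0 (blk i)) * X (blk i) *
          ∏ j ∈ range m, ∑ c, MvPolynomial.C (χ (j+1) c) * X c) := by
      intro i hi
      have hnpos : n (blk i) ≠ 0 := by
        rw [hn]
        have : Nonempty {j // blk j = blk i} := ⟨⟨i, rfl⟩⟩
        exact Fintype.card_ne_zero
      rw [Psi_flip T m hT blk rk s χ hs i hi, mul_assoc, coeff_C_mul]
      congr 1
      rw [mul_comm, coeff_mul_X', if_pos (Finsupp.mem_support_iff.2 hnpos)]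
      refine ih {x // x ≠ i} (fun x => blk x.1) (fun x => rk x.1) ?_ ?_ _ (fun j => χ (j+1)) ?_ _ ?_
      · intro a b h1 h2; exact Subtype.ext (hrk _ _ h1 h2)
      · rw [Fintype.card_subtype_compl]; simp [hm]
      · intro j
        constructor
        · intro x a a' y hx hb hr
          have : ext i 0 (Function.update x a' y) = Function.update (ext i 0 x) a'.1 y := by
            funext z
            by_cases hz : z = i
            · have : z ≠ a'.1 := by rw [hz]; exact a'.2.symm
              rw [Function.update_of_ne this]; simp [ext, hz]
            · by_cases hz' : z = a'.1
              · subst hz'; simp [ext, hz]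
              · rw [Function.update_of_ne hz']
                have : (⟨z, hz⟩ : {x // x ≠ i}) ≠ a' := fun h => hz' (congrArg Subtype.val h)
                simp [ext, hz, Function.update_of_ne this]
          simp only [this]
          exact (hs (j+1)).deg _ a.1 a'.1 _ (by simpa [ext, a.2] using hx) hb hr
        · intro x a hx ha hxa
          by_cases hb : blk a.1 = blk i
          · have h2 := (hs (j+1)).flip (ext i 0 x) i ?_ hi (by simp [ext])
            · rw [← hb] at h2
              have h3 : ext i 0 (bflip T (fun x : {x // x ≠ i} => blk x.1) (blk a.1) x) =
                  Function.update (bflip T blk (blk a.1) (ext i 0 x)) i 0 := by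
                funext z
                by_cases hz : z = i
                · subst hz; simp [ext]
                · rw [Function.update_of_ne hz]; simp [ext, hz, bflip]
              simp only [h3]
              rw [← h2]
              refine (hs (j+1)).deg _ a.1 i 0 ?_ hb.symm ?_
              · right; simp [bflip, ext, a.2, hxa]
              · refine lt_of_le_of_ne (hi _ hb) fun h => a.2 (hrk _ _ hb h.symm)
            · intro z
              by_cases hz : z = i
              · simp [ext, hz]
              · simp [ext, hz, hx]
          · have h2 := (hs (j+1)).flip (ext i 0 x) a.1 ?_ ?_ (by simp [ext, a.2, hxa])
            · rw [← h2]
              congr 1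
              funext z
              by_cases hz : z = i
              · subst hz; simp only [ext, bflip, dif_pos]; rw [if_neg fun h => hb h.symm]
              · simp [ext, hz, bflip]
            · intro z
              by_cases hz : z = i
              · simp [ext, hz]
              · simp [ext, hz, hx]
            · intro z hz
              by_cases hzi : z = i
              · subst hzi; exact absurd hz.symm hb
              · exact ha ⟨z, hzi⟩ hz
      · intro c
        rw [Finsupp.tsub_apply, hn]
        by_cases hc : blk i = c
        · subst hc
          simp only [Finsupp.single_eq_same]
          have e1 : Fintype.card {z : {x // x ≠ i} // blk z.1 = blk i} =
              (Finset.univ.filter (fun z => blk z = blk i) |>.erase i).card := by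
            rw [Fintype.card_subtype]
            refine Finset.card_bij (fun z _ => z.1) ?_ ?_ ?_
            · intro z hz; simpa [z.2] using hz
            · intro a _ b _ h; exact Subtype.ext h
            · intro z hz
              simp only [mem_erase, mem_filter, mem_univ, true_and] at hz
              exact ⟨⟨z, hz.1⟩, by simpa using hz.2, rfl⟩
          rw [e1, Finset.card_erase_of_mem (by simp), Fintype.card_subtype]
        · rw [Finsupp.single_eq_of_ne (by exact fun h => hc h.symm), Nat.sub_zero]
          rw [Fintype.card_subtype, Fintype.card_subtype]
          symm
          refine Finset.card_bij (fun z _ => z.1) ?_ ?_ ?_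
          · intro z hz; simpa using hz
          · intro a _ b _ h; exact Subtype.ext h
          · intro z hz
            simp only [mem_filter, mem_univ, true_and] at hz
            exact ⟨⟨z, fun h => hc (h ▸ hz)⟩, by simpa using hz, rfl⟩
    rw [← Finset.sum_fiberwise (s := Finset.univ) (g := blk)]
    refine Finset.sum_congr rfl fun c _ => ?_
    by_cases hc : n c = 0
    · rw [mul_assoc, coeff_C_mul, mul_comm (X c), coeff_mul_X',
        if_neg (by simpa using hc), mul_zero]
      have : IsEmpty {i // blk i = c} := by rw [hn] at hc; exact Fintype.card_eq_zero_iff.1 hc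
      refine Finset.sum_eq_zero fun i hi => ?_
      exact (this.false ⟨i, by simpa using hi⟩).elim
    · have hne : (Finset.univ.filter (fun i => blk i = c)).Nonempty := by
        rw [hn, Fintype.card_subtype] at hc
        exact Finset.card_pos.1 (Nat.pos_of_ne_zero hc)
      obtain ⟨i0, hi0, hmin⟩ := Finset.exists_min_image _ rk hne
      simp only [mem_filter, mem_univ, true_and] at hi0 hmin
      subst hi0
      rw [Finset.sum_eq_single_of_mem i0 (by simp)]
      · rw [hstep i0 hmin]
      · intro i hi hne'
        simp only [mem_filter, mem_univ, true_and] at hi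
        have hlt : rk i0 < rk i := lt_of_le_of_ne (hmin i hi) fun h => hne' (hrk _ _ hi h.symm)
        rw [Psi_deg T m hT blk rk s χ hs i i0 hi.symm hlt 0 (Or.inl rfl),
          Psi_deg T m hT blk rk s χ hs i i0 hi.symm hlt T (Or.inr rfl), add_zero]

end BU

end PartA

section PartB
open Finset

namespace BU

variable {κ : Type} [DecidableEq κ] [Fintype κ]

/-- canonical sign function of the block `c` on the grid with even side `T = 2 * K` -/
noncomputable def sg {ι : Type} (K : ℕ) (blk : ι → κ) (rk : ι → ℕ) (c : κ) (x : ι → ℕ) : ZMod 2 := by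
  classical
  exact if ∃ i, blk i = c ∧ K < x i ∧ ∀ i', blk i' = c → rk i < rk i' → x i' = K then 1 else 0

lemma sg_deg {ι : Type} [DecidableEq ι] (K : ℕ) (hK : 0 < K) (blk : ι → κ) (rk : ι → ℕ) 
    (hrk : ∀ i i', blk i = blk i' → rk i = rk i' → i = i') (c : κ)
    (x : ι → ℕ) (i i' : ι) (y : ℕ) (hx : x i = 0 ∨ x i = 2 * K) (hb : blk i' = blk i)
    (hr : rk i' < rk i) : sg K blk rk c (Function.update x i' y) = sg K blk rk c x := by
  have key : (∃ a, blk a = c ∧ K < Function.update x i' y a ∧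
      ∀ b, blk b = c → rk a < rk b → Function.update x i' y b = K) ↔
      (∃ a, blk a = c ∧ K < x a ∧ ∀ b, blk b = c → rk a < rk b → x b = K) := by
    refine exists_congr fun a => and_congr_right fun ha => ?_
    by_cases hc : blk i = c
    · have hne : i ≠ i' := by rintro rfl; omega
      by_cases hle : rk i ≤ rk a
      · have hai : a ≠ i' := by rintro rfl; omega
        rw [Function.update_of_ne hai]
        refine and_congr_right fun _ => forall_congr' fun b => forall_congr' fun _ =>
          forall_congr' fun hab => ?_
        have : b ≠ i' := by rintro rfl; omega
        rw [Function.update_of_ne this]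
      · constructor
        · rintro ⟨_, h⟩
          have := h i hc (by omega)
          rw [Function.update_of_ne hne] at this; omega
        · rintro ⟨_, h⟩
          have := h i hc (by omega)
          omega
    · have hai : a ≠ i' := by rintro rfl; exact hc (hb ▸ ha)
      rw [Function.update_of_ne hai]
      refine and_congr_right fun _ => forall_congr' fun b => forall_congr' fun hbc =>
          forall_congr' fun hab => ?_
      have : b ≠ i' := by rintro rfl; exact hc (hb ▸ hbc)
      rw [Function.update_of_ne this]
  unfold sg
  congr 1
  rw [eq_iff_iff]
  exact key

lemma sg_flip {ι : Type} [Fintype ι] [DecidableEq ι] (K : ℕ) (hK : 0 < K) (blk : ι → κ) (rk : ι → ℕ)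
    (hrk : ∀ i i', blk i = blk i' → rk i = rk i' → i = i') (c : κ)
    (x : ι → ℕ) (i : ι) (hx : ∀ i', x i' ≤ 2 * K) (hxi : x i = 0) :
    sg K blk rk c (bflip (2 * K) blk (blk i) x) =
      sg K blk rk c x + (if blk i = c then 1 else 0) := by
  by_cases hc : blk i = c
  · -- top nonzero index
    subst hc
    obtain ⟨t, ht, hmax⟩ := Finset.exists_max_image
      (Finset.univ.filter fun a => blk a = blk i ∧ x a ≠ K) rk ⟨i, by simp; omega⟩
    simp only [mem_filter, mem_univ, true_and] at ht hmax
    have h1 : ∀ z : ι → ℕ, (∀ a, blk a = blk i → (z a = K ↔ x a = K)) →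
        ((∃ a, blk a = blk i ∧ K < z a ∧ ∀ b, blk b = blk i → rk a < rk b → z b = K) ↔
          K < z t) := by
      intro z hz
      constructor
      · rintro ⟨a, ha, haK, h⟩
        have hle := hmax a ⟨ha, fun h => by have := (hz a ha).2 h; omega⟩
        have : ¬ rk a < rk t := fun hlt => ht.2 ((hz t ht.1).1 (h t ht.1 hlt))
        have : a = t := hrk _ _ (ha.trans ht.1.symm) (by omega)
        exact this ▸ haK
      · intro h
        refine ⟨t, ht.1, h, fun b hb hlt => ?_⟩
        rw [hz b hb]
        by_contra hne
        have := hmax b ⟨hb, hne⟩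
        omega
    have hft : bflip (2*K) blk (blk i) x t = 2 * K - x t := by simp [bflip, ht.1]
    have hxt := hx t
    unfold sg
    simp only [h1 x (fun _ _ => Iff.rfl), h1 (bflip (2*K) blk (blk i) x) (fun a ha => by
      have := hx a; simp only [bflip, ha, if_true]; omega), hft, if_true]
    have ht2 := ht.2
    by_cases hh : K < x t
    · rw [if_pos hh, if_neg (by omega)]; decide
    · rw [if_neg hh, if_pos (by omega)]; decide
  · rw [if_neg hc, add_zero]
    have key : ∀ a, blk a = c → bflip (2*K) blk (blk i) x a = x a := by
      intro a ha
      simp only [bflip]; rw [if_neg (by rw [ha]; exact fun h => hc h.symm)]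
    unfold sg
    congr 1
    rw [eq_iff_iff]
    refine exists_congr fun a => and_congr_right fun ha => ?_
    rw [key a ha]
    refine and_congr_right fun _ => forall_congr' fun b => forall_congr' fun hb => ?_
    rw [key b hb]

open MvPolynomial in
/-- Borsuk-Ulam theorem for products of spheres, in spherical coordinates on a cube. -/
theorem cubeBU {ι : Type} [Fintype ι] [DecidableEq ι] (m : ℕ) (blk : ι → κ) (rk : ι → ℕ)
    (hrk : ∀ i i', blk i = blk i' → rk i = rk i' → i = i')
    (hm : Fintype.card ι = m)
    (f : ℕ → (ι → ℝ) → ℝ) (χ : ℕ → κ → ZMod 2)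
    (hf : ∀ j, Continuous (f j))
    (hdeg : ∀ j x i i' y, (x i = 0 ∨ x i = 1) → blk i' = blk i → rk i' < rk i →
      f j (Function.update x i' y) = f j x)
    (hflip : ∀ j x i, (∀ i', blk i' = blk i → rk i ≤ rk i') → x i = 0 →
      f j (fun a => if blk a = blk i then 1 - x a else x a) =
        (if χ j (blk i) = 0 then 1 else -1) * f j x)
    (n : κ →₀ ℕ) (hn : ∀ c, n c = Fintype.card {i // blk i = c})
    (hcoef : coeff n (∏ j ∈ range m, ∑ c, MvPolynomial.C (χ j c) * X c) ≠ 0) :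
    ∃ x, ∀ j < m, f j x = 0 := by
  by_contra hno
  push Not at hno
  -- Lebesgue number
  have hcomp : IsCompact (Set.Icc (0 : ι → ℝ) 1) := isCompact_Icc
  obtain ⟨δ, hδ, hL⟩ := lebesgue_number_lemma_of_metric (ι := Fin m) hcomp
    (c := fun j => {x | f j x ≠ 0})
    (fun j => isOpen_ne_fun (hf j) continuous_const)
    (by
      intro x _
      obtain ⟨j, hj, hx⟩ := hno x
      exact Set.mem_iUnion.2 ⟨⟨j, hj⟩, hx⟩)
  obtain ⟨K, hK⟩ := exists_nat_gt (1/δ)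
  have hK0 : 0 < K := by
    have : (0:ℝ) < K := lt_trans (by positivity) hK
    exact_mod_cast this
  have hKR : (0:ℝ) < K := by exact_mod_cast hK0
  let sc : (ι → ℕ) → (ι → ℝ) := fun x i => (x i : ℝ) / (2 * K)
  let s : ℕ → (ι → ℕ) → ZMod 2 := fun j x =>
    if f j (sc x) = 0 then ∑ c, χ j c * sg K blk rk c x else if f j (sc x) < 0 then 1 else 0
  have hs : ∀ j, Sym (2 * K) blk rk (s j) (χ j) := by
    intro j
    constructor
    · intro x i i' y hx hb hr
      have h1 : sc (Function.update x i' y) = Function.update (sc x) i' ((y:ℝ) / (2*K)) := by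
        funext a
        by_cases ha : a = i'
        · subst ha; simp [sc]
        · simp [sc, Function.update_of_ne ha]
      have h2 : f j (sc (Function.update x i' y)) = f j (sc x) := by
        rw [h1]
        refine hdeg j _ i i' _ ?_ hb hr
        rcases hx with hx | hx
        · left; simp [sc, hx]
        · right; simp only [sc, hx]; push_cast; field_simp
      simp only [s, h2, sg_deg K hK0 blk rk hrk _ x i i' y hx hb hr]
    · intro x i hx hmin hxi
      have h1 : sc (bflip (2*K) blk (blk i) x) =
          (fun a => if blk a = blk i then 1 - sc x a else sc x a) := by
        funext a
        by_cases ha : blk a = blk i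
        · simp only [sc, bflip, ha, if_true]
          rw [Nat.cast_sub (hx a)]; push_cast; field_simp
        · simp [sc, bflip, ha]
      have h2 := hflip j (sc x) i hmin (by simp [sc, hxi])
      rw [← h1] at h2
      have h3 : ∑ c, χ j c * sg K blk rk c (bflip (2*K) blk (blk i) x) =
          ∑ c, χ j c * sg K blk rk c x + χ j (blk i) := by
        simp_rw [sg_flip K hK0 blk rk hrk _ x i hx hxi, mul_add, Finset.sum_add_distrib]
        simp
      simp only [s, h2, h3]
      have h01 : χ j (blk i) = 0 ∨ χ j (blk i) = 1 := by
        generalize χ j (blk i) = a; revert a; decide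
      rcases h01 with h | h
      · simp [h]
      · simp only [h, one_ne_zero, if_false, neg_mul, one_mul, neg_eq_zero]
        rcases lt_trichotomy (f j (sc x)) 0 with h' | h' | h'
        · rw [if_neg h'.ne, if_neg h'.ne, if_pos h', if_neg (by linarith)]; decide
        · simp [h']
        · rw [if_neg h'.ne', if_neg h'.ne', if_pos (by linarith), if_neg (by linarith)]; decide
  have hPhi := Phi_eq (2 * K) (by omega) (by omega) m ι blk rk hrk hm s χ hs n hn
  rw [← hPhi] at hcoef
  apply hcoef
  unfold Phi
  refine Finset.sum_eq_zero fun y hy => ?_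
  simp only [Sx, mem_product, Fintype.mem_piFinset, Finset.mem_range, mem_univ, and_true] at hy
  have hmem : sc (V y.2 y.1 0) ∈ Set.Icc (0 : ι → ℝ) 1 := by
    constructor
    · intro i; simp only [sc, Pi.zero_apply]; positivity
    · intro i
      have := V_le (2*K) (by omega) y.2 y.1 hy 0 i
      have h2 : ((V y.2 y.1 0 i : ℕ) : ℝ) ≤ 2 * K := by exact_mod_cast this
      simp only [sc, Pi.one_apply]
      rw [div_le_one (by positivity)]; exact h2
  obtain ⟨j, hj⟩ := hL _ hmem
  refine Finset.prod_eq_zero (Finset.mem_range.2 j.2) ?_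
  have hball : ∀ l, sc (V y.2 y.1 l) ∈ Metric.ball (sc (V y.2 y.1 0)) δ := by
    intro l
    rw [Metric.mem_ball, dist_pi_lt_iff hδ]
    intro i
    have : |((V y.2 y.1 l i : ℕ) : ℝ) - (V y.2 y.1 0 i : ℕ)| ≤ 1 := by
      have h1 : (V y.2 y.1 l i) ≤ V y.2 y.1 0 i + 1 ∧ (V y.2 y.1 0 i) ≤ V y.2 y.1 l i + 1 := by
        unfold V ev od; constructor <;> split_ifs <;> omega
      have h2 : ((V y.2 y.1 l i : ℕ) : ℝ) ≤ (V y.2 y.1 0 i : ℕ) + 1 := by exact_mod_cast h1.1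
      have h3 : ((V y.2 y.1 0 i : ℕ) : ℝ) ≤ (V y.2 y.1 l i : ℕ) + 1 := by exact_mod_cast h1.2
      rw [abs_le]; constructor <;> linarith
    simp only [sc]
    rw [Real.dist_eq, ← sub_div, abs_div, abs_of_pos (by positivity : (0:ℝ) < 2 * K)]
    rw [div_lt_iff₀ (by positivity)]
    rw [div_lt_iff₀ hδ] at hK
    nlinarith
  have hsame : ∀ l l', f j (sc (V y.2 y.1 l)) < 0 → f j (sc (V y.2 y.1 l')) < 0 := by
    intro l l' hl
    by_contra hl'
    push Not at hl'
    have hpc : IsPreconnected (Metric.ball (sc (V y.2 y.1 0)) δ) :=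
      (convex_ball _ _).isPreconnected
    obtain ⟨z, hz, hz0⟩ := hpc.intermediate_value (hball l) (hball l') (hf j).continuousOn
      (show (0:ℝ) ∈ Set.Icc _ _ from ⟨hl.le, hl'⟩)
    exact hj hz hz0
  simp only [Df, s]
  rw [if_neg (hj (hball _)), if_neg (hj (hball _))]
  have : f j (sc (V y.2 y.1 j)) < 0 ↔ f j (sc (V y.2 y.1 (j+1))) < 0 := ⟨hsame _ _, hsame _ _⟩
  simp only [this]
  exact z2_add_self _

end BU

end PartB

section PartC
open Finset

namespace BU

/-- coordinate factor -/
noncomputable def cf (n : ℕ) (θ : Fin n → ℝ) : ℕ → ℝ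
  | 0 => 1
  | k+1 => if h : k < n then 1 - 2 * θ ⟨k, h⟩ else 0

/-- unnormalised spherical coordinates -/
noncomputable def sv (n : ℕ) (θ : Fin n → ℝ) (k : ℕ) : ℝ :=
  cf n θ k * ∏ i : Fin n, if k ≤ (i : ℕ) then θ i * (1 - θ i) else 1

lemma sv_cont (n k : ℕ) : Continuous fun θ : Fin n → ℝ => sv n θ k := by
  unfold sv
  refine Continuous.mul ?_ ?_
  · cases k with
    | zero => simp only [cf]; fun_prop
    | succ k =>
      simp only [cf]
      split_ifs <;> fun_prop
  · refine continuous_finset_prod _ fun i _ => ?_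
    split_ifs <;> fun_prop

lemma sv_ne (n : ℕ) (θ : Fin n → ℝ) : ∃ k ≤ n, sv n θ k ≠ 0 := by
  classical
  by_cases h : ∃ i, θ i * (1 - θ i) = 0
  · obtain ⟨i, hi, hmax⟩ := Finset.exists_max_image
      (Finset.univ.filter fun i => θ i * (1 - θ i) = 0) (fun i => (i : ℕ))
      (by obtain ⟨i, hi⟩ := h; exact ⟨i, by simpa using hi⟩)
    simp only [mem_filter, mem_univ, true_and] at hi hmax
    refine ⟨i + 1, i.2, mul_ne_zero ?_ (Finset.prod_ne_zero_iff.2 fun j _ => ?_)⟩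
    · simp only [cf, i.2, dif_pos]
      intro h0
      have : θ i = 1/2 := by linarith
      rw [this] at hi; norm_num at hi
    · split_ifs with hj
      · intro h0
        have := hmax j h0
        omega
      · exact one_ne_zero
  · push Not at h
    refine ⟨0, Nat.zero_le _, mul_ne_zero (by simp [cf]) (Finset.prod_ne_zero_iff.2 fun j _ => ?_)⟩
    split_ifs
    · exact h j
    · exact one_ne_zero

lemma sv_deg (n : ℕ) (θ : Fin n → ℝ) (i i' : Fin n) (y : ℝ) (h : θ i = 0 ∨ θ i = 1)
    (hlt : (i' : ℕ) < i) (k : ℕ) : sv n (Function.update θ i' y) k = sv n θ k := by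
  have hne : i ≠ i' := by rintro rfl; omega
  have hs : θ i * (1 - θ i) = 0 := by rcases h with h | h <;> rw [h] <;> norm_num
  unfold sv
  by_cases hk : k ≤ (i : ℕ)
  · rw [Finset.prod_eq_zero (mem_univ i), Finset.prod_eq_zero (mem_univ i)]
    · simp
    · rw [if_pos hk, hs]
    · rw [if_pos hk, Function.update_of_ne hne, hs]
  · congr 1
    · obtain ⟨k, rfl⟩ : ∃ l, k = l + 1 := ⟨k - 1, by omega⟩
      simp only [cf]
      split_ifs with hkn
      · rw [Function.update_of_ne]
        intro he
        rw [← he] at hlt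
        simp at hlt; omega
      · rfl
    · refine Finset.prod_congr rfl fun j _ => ?_
      split_ifs with hj
      · rw [Function.update_of_ne]
        rintro rfl; omega
      · rfl

lemma sv_flip (n : ℕ) (θ : Fin n → ℝ) (i : Fin n) (hi : (i : ℕ) = 0) (h : θ i = 0) (k : ℕ) :
    sv n (fun j => 1 - θ j) k = - sv n θ k := by
  unfold sv
  cases k with
  | zero =>
    rw [Finset.prod_eq_zero (mem_univ i), Finset.prod_eq_zero (mem_univ i)]
    · simp
    · simp [h]
    · simp [h]
  | succ k =>
    rw [← neg_mul]
    congr 1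
    · simp only [cf]
      split_ifs
      · ring
      · simp
    · refine Finset.prod_congr rfl fun j _ => ?_
      split_ifs
      · ring
      · rfl

open MvPolynomial in
/-- Borsuk-Ulam theorem for products of spheres. -/
theorem sphereBU {κ : Type} [DecidableEq κ] [Fintype κ] {J : Type} [Fintype J] (D : ℕ)
    (f : J → (κ → Fin (D+1) → ℝ) → ℝ) (χ : J → κ → ZMod 2)
    (hf : ∀ j, ContinuousOn (f j) {v | ∀ c, v c ≠ 0})
    (hflip : ∀ j v c, (∀ c, v c ≠ 0) → f j (Function.update v c (-(v c))) =
      (if χ j c = 0 then 1 else -1) * f j v)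
    (n : κ →₀ ℕ) (hnD : ∀ c, n c ≤ D) (hJ : ∑ c, n c = Fintype.card J)
    (hcoef : coeff n (∏ j, ∑ c, MvPolynomial.C (χ j c) * X c) ≠ 0) :
    ∃ v, (∀ c, v c ≠ 0) ∧ ∀ j, f j v = 0 := by
  classical
  let e := (Fintype.equivFin J).symm
  let g : ℕ → (((c : κ) × Fin (n c)) → ℝ) → ℝ := fun j x =>
    if h : j < Fintype.card J then
      f (e ⟨j, h⟩) (fun c k => sv (n c) (fun i => x ⟨c, i⟩) k) else 0
  let ψ : ℕ → κ → ZMod 2 := fun j => if h : j < Fintype.card J then χ (e ⟨j, h⟩) else 0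
  have hne : ∀ x : ((c : κ) × Fin (n c)) → ℝ, ∀ c,
      (fun k : Fin (D+1) => sv (n c) (fun i => x ⟨c, i⟩) k) ≠ 0 := by
    intro x c h0
    obtain ⟨k, hk, hs⟩ := sv_ne (n c) (fun i => x ⟨c, i⟩)
    have := congrFun h0 ⟨k, by have := hnD c; omega⟩
    exact hs this
  obtain ⟨x, hx⟩ := cubeBU (ι := (c : κ) × Fin (n c)) (Fintype.card J) Sigma.fst (fun i => i.2)
    (by
      rintro ⟨c, i⟩ ⟨c', i'⟩ h h'
      dsimp only at h h'
      subst h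
      rw [Fin.ext h'])
    (by simp [hJ]) g ψ
    (by
      intro j
      by_cases hj : j < Fintype.card J
      · simp only [g, hj, dif_pos]
        refine (hf _).comp_continuous ?_ (fun x => hne x)
        refine continuous_pi fun c => continuous_pi fun k => ?_
        exact (sv_cont (n c) k).comp (by fun_prop)
      · simp only [g, hj, dif_neg, not_false_iff]; fun_prop)
    (by
      rintro j x ⟨c, i⟩ ⟨c', i'⟩ y hx hc hlt
      dsimp only at hc hlt
      subst hc
      have : (fun a (k : Fin (D+1)) => sv (n a) (fun i_1 => Function.update x ⟨c', i'⟩ y ⟨a, i_1⟩) k)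
         = (fun a (k : Fin (D+1)) => sv (n a) (fun i_1 => x ⟨a, i_1⟩) k) := by
        funext a k
        by_cases ha : a = c'
        · subst ha
          have h2 : (fun i_1 => Function.update x ⟨a, i'⟩ y ⟨a, i_1⟩) =
              Function.update (fun i_1 => x ⟨a, i_1⟩) i' y := by
            funext b
            by_cases hb : b = i'
            · subst hb; simp
            · rw [Function.update_of_ne hb, Function.update_of_ne]
              intro h; simp at h; exact hb h
          rw [h2]
          exact sv_deg (n a) _ i i' y hx hlt k
        · congr 1
          funext b
          rw [Function.update_of_ne]
          intro h
          rw [Sigma.mk.injEq] at h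
          exact ha h.1
      simp only [g, this])
    (by
      rintro j x ⟨c, i⟩ hmin hxi
      have hi0 : (i : ℕ) = 0 := by
        have := hmin ⟨c, ⟨0, i.pos⟩⟩ rfl
        simp at this; exact this
      by_cases hj : j < Fintype.card J
      · simp only [g, ψ, hj, dif_pos]
        rw [← hflip _ _ c (hne x)]
        congr 1
        funext a
        by_cases ha : a = c
        · subst ha
          funext k
          simp only [Function.update_self, if_true, Pi.neg_apply]
          exact sv_flip (n a) (fun b => x ⟨a, b⟩) i hi0 hxi k
        · rw [Function.update_of_ne ha]
          simp only [ha, if_false]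
      · simp only [g, hj, dif_neg, not_false_iff, mul_zero])
    n
    (by
      intro c
      have h2 : Fintype.card {i : (c : κ) × Fin (n c) // i.fst = c} = Fintype.card (Fin (n c)) :=
        Fintype.card_congr (Equiv.sigmaSubtype c)
      rw [h2, Fintype.card_fin])
    (by
      convert hcoef using 2
      rw [Finset.prod_range]
      rw [← e.prod_comp]
      refine Finset.prod_congr rfl fun j _ => ?_
      simp only [ψ, j.2, dif_pos])
  refine ⟨_, hne x, fun j => ?_⟩
  have := hx (e.symm j) (e.symm j).2
  simp only [g, (e.symm j).2, dif_pos] at this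
  simpa using this

end BU

end PartC

section PartD
open Finset

namespace BU

abbrev Q4 := ℕ × ℕ × ℕ × ℕ

/-- exponent vector of a quadruple -/
noncomputable def mo (t : Q4) : Fin 4 →₀ ℕ :=
  Finsupp.equivFunOnFinite.symm ![t.1, t.2.1, t.2.2.1, t.2.2.2]

/-- polynomial of a list of exponents -/
noncomputable def toP (l : List Q4) : MvPolynomial (Fin 4) (ZMod 2) :=
  (l.map fun t => MvPolynomial.monomial (mo t) 1).sum

/-- toggle a monomial -/
def toggle (t : Q4) : List Q4 → List Q4
  | [] => [t]
  | a :: l => if a = t then l else a :: toggle t l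

def bump : Fin 4 → Q4 → Q4
  | 0, t => (t.1 + 1, t.2)
  | 1, t => (t.1, t.2.1 + 1, t.2.2)
  | 2, t => (t.1, t.2.1, t.2.2.1 + 1, t.2.2.2)
  | 3, t => (t.1, t.2.1, t.2.2.1, t.2.2.2 + 1)

def toggles (l l' : List Q4) : List Q4 := l.foldr toggle l'

def mulLin (S : List (Fin 4)) (l : List Q4) : List Q4 :=
  S.foldr (fun c acc => toggles (l.map (bump c)) acc) []

def mulAll (L : List (List (Fin 4))) : List Q4 := L.foldr mulLin [(0,0,0,0)]

lemma P_add_self (p : MvPolynomial (Fin 4) (ZMod 2)) : p + p = 0 := by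
  have : (2 : MvPolynomial (Fin 4) (ZMod 2)) = 0 := CharP.cast_eq_zero _ 2
  rw [← two_mul, this, zero_mul]

lemma toP_cons (t : Q4) (l : List Q4) :
    toP (t :: l) = MvPolynomial.monomial (mo t) 1 + toP l := by simp [toP]

lemma toP_toggle (t : Q4) (l : List Q4) :
    toP (toggle t l) = MvPolynomial.monomial (mo t) 1 + toP l := by
  induction l with
  | nil => simp [toggle, toP]
  | cons a l ih =>
    unfold toggle
    split_ifs with h
    · subst h
      rw [toP_cons, ← add_assoc, P_add_self, zero_add]
    · rw [toP_cons, ih, toP_cons]; ring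

lemma toP_toggles (l l' : List Q4) : toP (toggles l l') = toP l + toP l' := by
  induction l with
  | nil => simp [toggles, toP]
  | cons a l ih =>
    have : toggles (a :: l) l' = toggle a (toggles l l') := rfl
    rw [this, toP_toggle, ih, toP_cons]; ring

lemma mo_bump (c : Fin 4) (t : Q4) : mo (bump c t) = Finsupp.single c 1 + mo t := by
  ext i
  fin_cases c <;> fin_cases i <;> simp [mo, bump, add_comm]

lemma toP_bump (c : Fin 4) (l : List Q4) :
    toP (l.map (bump c)) = MvPolynomial.X c * toP l := by
  induction l with
  | nil => simp [toP]
  | cons a l ih =>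
    rw [List.map_cons, toP_cons, ih, toP_cons, mul_add, mo_bump, MvPolynomial.X,
      MvPolynomial.monomial_mul, one_mul]

lemma toP_mulLin (S : List (Fin 4)) (l : List Q4) :
    toP (mulLin S l) = (S.map fun c => (MvPolynomial.X c : MvPolynomial (Fin 4) (ZMod 2))).sum *
      toP l := by
  induction S with
  | nil => simp [mulLin, toP]
  | cons c S ih =>
    have : mulLin (c :: S) l = toggles (l.map (bump c)) (mulLin S l) := rfl
    rw [this, toP_toggles, toP_bump, ih, List.map_cons, List.sum_cons]; ring

lemma toP_mulAll (L : List (List (Fin 4))) :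
    toP (mulAll L) = (L.map fun S =>
      (S.map fun c => (MvPolynomial.X c : MvPolynomial (Fin 4) (ZMod 2))).sum).prod := by
  induction L with
  | nil =>
    have : mo (0,0,0,0) = 0 := by ext i; fin_cases i <;> simp [mo]
    simp [mulAll, toP, this]
  | cons S L ih =>
    have : mulAll (S :: L) = mulLin S (mulAll L) := rfl
    rw [this, toP_mulLin, ih, List.map_cons, List.prod_cons]

/-- the linear form of a set -/
noncomputable def lin (S : Finset (Fin 4)) : MvPolynomial (Fin 4) (ZMod 2) :=
  ∑ c, MvPolynomial.C (if c ∈ S then 1 else 0) * MvPolynomial.X c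

lemma lin_toFinset (S : List (Fin 4)) (h : S.Nodup) :
    lin S.toFinset = (S.map fun c => (MvPolynomial.X c : MvPolynomial (Fin 4) (ZMod 2))).sum := by
  rw [← List.sum_toFinset _ h, lin]
  rw [← Finset.sum_filter_add_sum_filter_not Finset.univ (fun c => c ∈ S)]
  rw [Finset.sum_eq_zero (s := Finset.univ.filter fun c => ¬ c ∈ S), add_zero]
  · refine Finset.sum_congr ?_ ?_
    · ext; simp
    · intro x hx
      simp at hx
      simp [hx]
  · intro x hx
    simp at hx
    simp [hx]

def L7 : List (List (Fin 4)) := [[1,2,3],[1,2],[1,3],[2,3],[1],[2],[3]]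
def L14 : List (List (Fin 4)) := [[0,1,2],[0,1,3],[0,2,3],[0,1],[0,2],[0,3],[0]] ++ L7

def S14 : Finset (Finset (Fin 4)) := Finset.univ.filter fun S => S.Nonempty ∧ S.card ≤ 3
def S7 : Finset (Finset (Fin 4)) := Finset.univ.filter fun S => S.Nonempty ∧ 0 ∉ S

def l3 : List Q4 := [(0,4,2,1),(0,4,1,2),(0,2,4,1),(0,2,1,4),(0,1,2,4),(0,1,4,2)]

def supp : List Q4 :=
  [(1, 2, 4, 7), (1, 2, 5, 6), (1, 2, 6, 5), (1, 2, 7, 4), (1, 3, 4, 6), (1, 3, 6, 4), (1, 4, 2, 7), (1, 4, 3, 6),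
   (1, 4, 6, 3), (1, 4, 7, 2), (1, 5, 2, 6), (1, 5, 6, 2), (1, 6, 2, 5), (1, 6, 3, 4), (1, 6, 4, 3), (1, 6, 5, 2),
   (1, 7, 2, 4), (1, 7, 4, 2), (2, 1, 4, 7), (2, 1, 5, 6), (2, 1, 6, 5), (2, 1, 7, 4), (2, 3, 4, 5), (2, 3, 5, 4),
   (2, 4, 1, 7), (2, 4, 3, 5), (2, 4, 5, 3), (2, 4, 7, 1), (2, 5, 1, 6), (2, 5, 3, 4), (2, 5, 4, 3), (2, 5, 6, 1),
   (2, 6, 1, 5), (2, 6, 5, 1), (2, 7, 1, 4), (2, 7, 4, 1), (3, 1, 4, 6), (3, 1, 6, 4), (3, 2, 4, 5), (3, 2, 5, 4),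
   (3, 4, 1, 6), (3, 4, 2, 5), (3, 4, 5, 2), (3, 4, 6, 1), (3, 5, 2, 4), (3, 5, 4, 2), (3, 6, 1, 4), (3, 6, 4, 1),
   (4, 1, 2, 7), (4, 1, 3, 6), (4, 1, 6, 3), (4, 1, 7, 2), (4, 2, 1, 7), (4, 2, 3, 5), (4, 2, 5, 3), (4, 2, 7, 1),
   (4, 3, 1, 6), (4, 3, 2, 5), (4, 3, 5, 2), (4, 3, 6, 1), (4, 5, 2, 3), (4, 5, 3, 2), (4, 6, 1, 3), (4, 6, 3, 1),
   (4, 7, 1, 2), (4, 7, 2, 1), (5, 1, 2, 6), (5, 1, 6, 2), (5, 2, 1, 6), (5, 2, 3, 4), (5, 2, 4, 3), (5, 2, 6, 1),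
   (5, 3, 2, 4), (5, 3, 4, 2), (5, 4, 2, 3), (5, 4, 3, 2), (5, 6, 1, 2), (5, 6, 2, 1), (6, 1, 2, 5), (6, 1, 3, 4),
   (6, 1, 4, 3), (6, 1, 5, 2), (6, 2, 1, 5), (6, 2, 5, 1), (6, 3, 1, 4), (6, 3, 4, 1), (6, 4, 1, 3), (6, 4, 3, 1),
   (6, 5, 1, 2), (6, 5, 2, 1), (7, 1, 2, 4), (7, 1, 4, 2), (7, 2, 1, 4), (7, 2, 4, 1), (7, 4, 1, 2), (7, 4, 2, 1)]

lemma toP_eq_of (l l' : List Q4) (h : toggles l l' = []) : toP l = toP l' := by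
  have h1 := toP_toggles l l'
  rw [h] at h1
  have h2 : toP [] = 0 := by simp [toP]
  rw [h2] at h1
  calc toP l = toP l + toP l' + toP l' := by rw [add_assoc, P_add_self, add_zero]
    _ = toP l' := by rw [← h1, zero_add]

set_option maxRecDepth 100000 in
lemma l3_eq : toP l3 = toP (mulAll L7) := toP_eq_of _ _ (by decide +kernel)

set_option maxRecDepth 100000 in
lemma supp_eq : toP supp = toP (mulAll L14) := toP_eq_of _ _ (by decide +kernel)

lemma prod_lin (L : List (List (Fin 4))) (hn : ∀ S ∈ L, S.Nodup) (hL : (L.map List.toFinset).Nodup) :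
    ∏ S ∈ (L.map List.toFinset).toFinset, lin S = toP (mulAll L) := by
  rw [List.prod_toFinset _ hL, toP_mulAll, List.map_map]
  congr 1
  refine List.map_congr_left fun S hS => ?_
  exact lin_toFinset S (hn S hS)

lemma E_eq : ∏ S ∈ S14, lin S = toP supp := by
  rw [supp_eq, ← prod_lin]
  · congr 1
    decide +kernel
  · decide
  · decide

lemma L_eq : ∏ S ∈ S7, lin S = toP l3 := by
  rw [l3_eq, ← prod_lin]
  · congr 1
    decide +kernel
  · decide
  · decide

/-- the invariant coefficient pattern -/
def uu (a b c d : ℕ) : ZMod 2 :=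
  if a ≠ b ∧ a ≠ c ∧ a ≠ d ∧ b ≠ c ∧ b ≠ d ∧ c ≠ d then 1 else 0

def ev2 (a b c d : ℕ) (e : Q4) : Bool :=
  (a + e.1) % 2 == 0 && (b + e.2.1) % 2 == 0 && (c + e.2.2.1) % 2 == 0 && (d + e.2.2.2) % 2 == 0

lemma dist_bd (a : ℕ) (ha : a < 7) (b : ℕ) (hb : b < 7) (c : ℕ) (hc : c < 7) (d : ℕ) (hd : d < 7)
    (hs : a + b + c + d = 6) (h : a ≠ b ∧ a ≠ c ∧ a ≠ d ∧ b ≠ c ∧ b ≠ d ∧ c ≠ d) :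
    a ≤ 3 ∧ b ≤ 3 ∧ c ≤ 3 ∧ d ≤ 3 := by
  obtain ⟨h1, h2, h3, h4, h5, h6⟩ := h
  interval_cases a <;> interval_cases b <;> first | contradiction | omega

open MvPolynomial in
lemma term_eq (R : MvPolynomial (Fin 4) (ZMod 2)) (h t : ℕ) (ht : t % 2 = 0) (hh : 3 ≤ h)
    (hR : ∀ a b c d n0 n1 n2 n3, a + b + c + d = 6 → n0 + a = h → n1 + b = h → n2 + c = h →
      n3 + d = h → coeff (mo (n0, n1, n2, n3)) R = uu a b c d)
    (a b c d n0 n1 n2 n3 : ℕ) (e : Q4) (h0 : n0 + a = 2 * h + t) (h1 : n1 + b = 2 * h + t)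
    (h2 : n2 + c = 2 * h + t) (h3 : n3 + d = 2 * h + t)
    (hs : a + b + c + d + e.1 + e.2.1 + e.2.2.1 + e.2.2.2 = 12 + 4 * t)
    (ha : t ≤ a + e.1 + 1) (hb : t ≤ b + e.2.1 + 1) (hc : t ≤ c + e.2.2.1 + 1)
    (hd : t ≤ d + e.2.2.2 + 1) :
    coeff (mo (n0, n1, n2, n3)) (monomial (mo e) 1 * R ^ 2) =
      if ev2 a b c d e then uu ((a + e.1 - t) / 2) ((b + e.2.1 - t) / 2) ((c + e.2.2.1 - t) / 2)
        ((d + e.2.2.2 - t) / 2) else 0 := by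
  obtain ⟨e0, e1, e2, e3⟩ := e
  dsimp only at *
  have : Fact (Nat.Prime 2) := ⟨Nat.prime_two⟩
  rw [← expand_zmod, coeff_monomial_mul']
  have hle : mo (e0, e1, e2, e3) ≤ mo (n0, n1, n2, n3) ↔
      e0 ≤ n0 ∧ e1 ≤ n1 ∧ e2 ≤ n2 ∧ e3 ≤ n3 := by
    constructor
    · intro H
      exact ⟨H 0, H 1, H 2, H 3⟩
    · rintro ⟨h0, h1, h2, h3⟩ i
      fin_cases i <;> simpa [mo]
  have hsub : mo (n0, n1, n2, n3) - mo (e0, e1, e2, e3) = mo (n0 - e0, n1 - e1, n2 - e2, n3 - e3) := by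
    ext i
    fin_cases i <;> simp [mo]
  rw [hsub, one_mul]
  simp only [hle]
  by_cases hev : ev2 a b c d (e0, e1, e2, e3) = true
  · rw [if_pos hev]
    simp only [ev2, Bool.and_eq_true, beq_iff_eq] at hev
    obtain ⟨⟨⟨v0, v1⟩, v2⟩, v3⟩ := hev
    split_ifs with hcond
    · obtain ⟨w0, w1, w2, w3⟩ := hcond
      have : mo (n0 - e0, n1 - e1, n2 - e2, n3 - e3) =
          2 • mo ((n0 - e0)/2, (n1 - e1)/2, (n2 - e2)/2, (n3 - e3)/2) := by
        ext i
        fin_cases i <;> simp [mo] <;> omega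
      rw [this, coeff_expand_smul _ (by norm_num)]
      apply hR <;> omega
    · symm
      unfold uu
      rw [if_neg]
      intro H
      apply hcond
      have g0 : (a + e0 - t)/2 + (b + e1 - t)/2 + (c + e2 - t)/2 + (d + e3 - t)/2 = 6 := by omega
      obtain ⟨b0, b1, b2, b3⟩ := dist_bd _ (by omega) _ (by omega) _ (by omega) _ (by omega) g0 H
      clear H g0 hR
      refine ⟨?_, ?_, ?_, ?_⟩ <;> omega
  · rw [if_neg hev]
    split_ifs with hcond
    · obtain ⟨w0, w1, w2, w3⟩ := hcond
      simp only [ev2, Bool.and_eq_true, beq_iff_eq] at hev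
      have key : ¬ ((n0 - e0) % 2 = 0 ∧ (n1 - e1) % 2 = 0 ∧ (n2 - e2) % 2 = 0 ∧ (n3 - e3) % 2 = 0) := by
        intro hk
        apply hev
        omega
      rw [not_and_or, not_and_or, not_and_or] at key
      rcases key with k | k | k | k
      · exact coeff_expand_of_not_dvd _ (i := 0) (by simp [mo]; omega)
      · exact coeff_expand_of_not_dvd _ (i := 1) (by simp [mo]; omega)
      · exact coeff_expand_of_not_dvd _ (i := 2) (by simp [mo]; omega)
      · exact coeff_expand_of_not_dvd _ (i := 3) (by simp [mo]; omega)
    · rfl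

open MvPolynomial in
lemma sum_eq (R : MvPolynomial (Fin 4) (ZMod 2)) (h t : ℕ) (ht : t % 2 = 0) (hh : 3 ≤ h)
    (hR : ∀ a b c d n0 n1 n2 n3, a + b + c + d = 6 → n0 + a = h → n1 + b = h → n2 + c = h →
      n3 + d = h → coeff (mo (n0, n1, n2, n3)) R = uu a b c d)
    (a b c d n0 n1 n2 n3 : ℕ) (l : List Q4) (h0 : n0 + a = 2 * h + t) (h1 : n1 + b = 2 * h + t)
    (h2 : n2 + c = 2 * h + t) (h3 : n3 + d = 2 * h + t)
    (hl : ∀ e ∈ l, a + b + c + d + e.1 + e.2.1 + e.2.2.1 + e.2.2.2 = 12 + 4 * t ∧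
      t ≤ a + e.1 + 1 ∧ t ≤ b + e.2.1 + 1 ∧ t ≤ c + e.2.2.1 + 1 ∧ t ≤ d + e.2.2.2 + 1) :
    coeff (mo (n0, n1, n2, n3)) (toP l * R ^ 2) =
      (l.map fun e => if ev2 a b c d e then uu ((a + e.1 - t) / 2) ((b + e.2.1 - t) / 2)
        ((c + e.2.2.1 - t) / 2) ((d + e.2.2.2 - t) / 2) else 0).sum := by
  induction l with
  | nil => simp [toP]
  | cons e l ih =>
    rw [toP_cons, add_mul, coeff_add, List.map_cons, List.sum_cons,
      ih (fun e he => hl e (List.mem_cons_of_mem _ he))]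
    obtain ⟨g, g0, g1, g2, g3⟩ := hl e List.mem_cons_self
    rw [term_eq R h t ht hh hR a b c d n0 n1 n2 n3 e h0 h1 h2 h3 g g0 g1 g2 g3]

set_option maxRecDepth 100000 in
lemma step_check : ∀ a < 7, ∀ b < 7, ∀ c < 7, ∀ d < 7, a + b + c + d = 6 →
    (supp.map fun e => if ev2 a b c d e then uu ((a + e.1 - 2) / 2) ((b + e.2.1 - 2) / 2)
        ((c + e.2.2.1 - 2) / 2) ((d + e.2.2.2 - 2) / 2) else 0).sum = uu a b c d := by
  decide +kernel

set_option maxRecDepth 100000 in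
lemma base_check : ∀ a < 6, ∀ b < 6, ∀ c < 6, ∀ d < 6, a + b + c + d = 6 →
    (supp.map fun e => if e = (5 - a, 5 - b, 5 - c, 5 - d) then (1 : ZMod 2) else 0).sum
      = uu a b c d := by
  decide +kernel

lemma supp_bd : ∀ e ∈ supp, e.1 + e.2.1 + e.2.2.1 + e.2.2.2 = 14 ∧ 1 ≤ e.1 ∧ 1 ≤ e.2.1 ∧
    1 ≤ e.2.2.1 ∧ 1 ≤ e.2.2.2 := by decide +kernel

lemma mo_inj {s t : Q4} : mo s = mo t ↔ s = t := by
  constructor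
  · intro h
    obtain ⟨a, b, c, d⟩ := s
    obtain ⟨a', b', c', d'⟩ := t
    have h0 : a = a' := DFunLike.congr_fun h 0
    have h1 : b = b' := DFunLike.congr_fun h 1
    have h2 : c = c' := DFunLike.congr_fun h 2
    have h3 : d = d' := DFunLike.congr_fun h 3
    rw [h0, h1, h2, h3]
  · rintro rfl; rfl

open MvPolynomial in
lemma coeff_toP (t : Q4) (l : List Q4) :
    coeff (mo t) (toP l) = (l.map fun e => if e = t then (1 : ZMod 2) else 0).sum := by
  induction l with
  | nil => simp [toP]
  | cons e l ih =>
    rw [toP_cons, coeff_add, ih, coeff_monomial, List.map_cons, List.sum_cons]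
    simp only [mo_inj]

open MvPolynomial in
lemma R_coeff (q : ℕ) : ∀ a b c d n0 n1 n2 n3, a + b + c + d = 6 → n0 + a = 7 * 2 ^ q - 2 →
      n1 + b = 7 * 2 ^ q - 2 → n2 + c = 7 * 2 ^ q - 2 →
      n3 + d = 7 * 2 ^ q - 2 → coeff (mo (n0, n1, n2, n3)) (toP supp ^ (2 ^ (q + 1) - 1)) = uu a b c d := by
  induction q with
  | zero =>
    intro a b c d n0 n1 n2 n3 hs h0 h1 h2 h3
    norm_num at h0 h1 h2 h3 ⊢
    rw [coeff_toP]
    rw [← base_check a (by omega) b (by omega) c (by omega) d (by omega) hs]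
    have : (n0, n1, n2, n3) = (5 - a, 5 - b, 5 - c, 5 - d) := by
      simp only [Prod.mk.injEq]; omega
    rw [this]
  | succ q ih =>
    intro a b c d n0 n1 n2 n3 hs h0 h1 h2 h3
    have hp : 1 ≤ 2 ^ q := Nat.one_le_two_pow
    have e1 : 7 * 2 ^ (q + 1) - 2 = 2 * (7 * 2 ^ q - 2) + 2 := by rw [pow_succ]; omega
    have e2 : 2 ^ (q + 1 + 1) - 1 = 1 + (2 ^ (q + 1) - 1) * 2 := by
      rw [pow_succ 2 (q+1), pow_succ]; omega
    rw [e1] at h0 h1 h2 h3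
    rw [e2, pow_add, pow_one, pow_mul]
    rw [sum_eq _ (7 * 2 ^ q - 2) 2 (by norm_num) (by omega) ih a b c d n0 n1 n2 n3 supp h0 h1 h2 h3]
    · exact step_check a (by omega) b (by omega) c (by omega) d (by omega) hs
    · intro e he
      have := supp_bd e he
      omega

open MvPolynomial in
/-- the coefficient needed for the main theorem, with `q + 1` in place of `q` -/
theorem main_coeff (q D : ℕ) (hD : D = 7 * 2 ^ (q + 1) - 4) :
    coeff (mo (D, D, D - 1, D - 4)) ((∏ S ∈ S7, lin S) * (∏ S ∈ S14, lin S) ^ (2 ^ (q + 2) - 2)) = 1 := by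
  have hp : 1 ≤ 2 ^ q := Nat.one_le_two_pow
  have e1 : D = 2 * (7 * 2 ^ q - 2) := by rw [hD, pow_succ]; omega
  have e2 : 2 ^ (q + 2) - 2 = (2 ^ (q + 1) - 1) * 2 := by
    rw [pow_add 2 q 2, pow_succ]; omega
  rw [E_eq, L_eq, e2, pow_mul]
  rw [sum_eq _ (7 * 2 ^ q - 2) 0 (by norm_num) (by omega) (R_coeff q) 0 0 1 4 _ _ _ _ l3
    (by omega) (by omega) (by omega) (by omega)]
  · decide
  · decide

end BU

end PartD

noncomputable section MeasurePart
open Finset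

namespace BU

variable {d : ℕ}

/-- normal vector -/
def nv (w : Fin (d+1) → ℝ) : EuclideanSpace ℝ (Fin d) := WithLp.toLp 2 fun k => w k.succ

/-- the affine function of a coefficient vector -/
def LL (w : Fin (d+1) → ℝ) (x : EuclideanSpace ℝ (Fin d)) : ℝ := ∑ k, w k.succ * x k - w 0

lemma LL_eq (w : Fin (d+1) → ℝ) (x : EuclideanSpace ℝ (Fin d)) : LL w x = ⟪nv w, x⟫ - w 0 := by
  simp [LL, nv, PiLp.inner_apply, mul_comm]

lemma LL_neg (w : Fin (d+1) → ℝ) (x : EuclideanSpace ℝ (Fin d)) : LL (-w) x = - LL w x := by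
  simp [LL, Finset.sum_neg_distrib]; ring

lemma LL_cont_x (w : Fin (d+1) → ℝ) : Continuous (LL w) := by
  unfold LL; fun_prop

lemma LL_cont_w (x : EuclideanSpace ℝ (Fin d)) : Continuous fun w : Fin (d+1) → ℝ => LL w x := by
  unfold LL; fun_prop

lemma LL_null_vol (w : Fin (d+1) → ℝ) (hw : w ≠ 0) :
    volume {x : EuclideanSpace ℝ (Fin d) | LL w x = 0} = 0 := by
  let A : AffineSubspace ℝ (EuclideanSpace ℝ (Fin d)) :=
    { carrier := {x | LL w x = 0}
      smul_vsub_vadd_mem' := by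
        intro c p1 p2 p3 h1 h2 h3
        simp only [Set.mem_ofPred_eq, LL_eq] at *
        rw [vsub_eq_sub, vadd_eq_add, inner_add_right, inner_smul_right, inner_sub_right]
        linear_combination c * h1 - c * h2 + h3 }
  have hA : A ≠ ⊤ := by
    intro h
    have hall : ∀ x, LL w x = 0 := by
      intro x
      have : x ∈ A := by rw [h]; exact AffineSubspace.mem_top _ _ _
      exact this
    have h0 : w 0 = 0 := by
      have := hall 0
      simpa [LL] using this
    apply hw
    funext k
    refine Fin.cases h0 (fun k => ?_) k
    have := hall (nv w)
    rw [LL_eq, h0, sub_zero, inner_self_eq_zero] at this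
    have h2 : nv w k = 0 := by rw [this]; rfl
    simpa [nv] using h2
  exact Measure.addHaar_affineSubspace volume A hA

lemma LL_null (μ : Measure (EuclideanSpace ℝ (Fin d))) (hac : μ ≪ volume) (w : Fin (d+1) → ℝ)
    (hw : w ≠ 0) : ∀ᵐ x ∂μ, LL w x ≠ 0 := by
  rw [ae_iff]
  simp only [not_not]
  exact hac (LL_null_vol w hw)

lemma sign_meas : Measurable Real.sign := by
  unfold Real.sign
  refine Measurable.ite measurableSet_Iio measurable_const ?_
  exact Measurable.ite measurableSet_Ioi measurable_const measurable_const

lemma sign_abs_le (r : ℝ) : |Real.sign r| ≤ 1 := by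
  rcases Real.sign_apply_eq r with h | h | h <;> rw [h] <;> norm_num

lemma sign_contAt (r : ℝ) (hr : r ≠ 0) : ContinuousAt Real.sign r := by
  rcases lt_or_gt_of_ne hr with h | h
  · refine (continuousAt_const (y := (-1:ℝ))).congr ?_
    filter_upwards [Iio_mem_nhds h] with y hy
    exact (Real.sign_of_neg hy).symm
  · refine (continuousAt_const (y := (1:ℝ))).congr ?_
    filter_upwards [Ioi_mem_nhds h] with y hy
    exact (Real.sign_of_pos hy).symm

variable {κ : Type}

/-- product of signs -/
def sp (S : Finset κ) (v : κ → Fin (d+1) → ℝ) (x : EuclideanSpace ℝ (Fin d)) : ℝ :=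
  ∏ i ∈ S, Real.sign (LL (v i) x)

/-- the sign integral -/
def FF (μ : Measure (EuclideanSpace ℝ (Fin d))) (S : Finset κ) (v : κ → Fin (d+1) → ℝ) : ℝ :=
  ∫ x, sp S v x ∂μ

lemma sp_meas (S : Finset κ) (v : κ → Fin (d+1) → ℝ) : Measurable (sp S v) := by
  unfold sp
  exact Finset.measurable_prod _ fun i _ => sign_meas.comp (LL_cont_x _).measurable

lemma sp_bd (S : Finset κ) (v : κ → Fin (d+1) → ℝ) (x : EuclideanSpace ℝ (Fin d)) :
    ‖sp S v x‖ ≤ 1 := by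
  unfold sp
  rw [Real.norm_eq_abs, Finset.abs_prod]
  exact Finset.prod_le_one (fun _ _ => abs_nonneg _) fun _ _ => sign_abs_le _

lemma sp_int (μ : Measure (EuclideanSpace ℝ (Fin d))) [IsFiniteMeasure μ] (S : Finset κ)
    (v : κ → Fin (d+1) → ℝ) : Integrable (sp S v) μ :=
  Integrable.of_bound (sp_meas S v).aestronglyMeasurable 1 (Filter.Eventually.of_forall (sp_bd S v))

lemma FF_contAt [Countable κ] (μ : Measure (EuclideanSpace ℝ (Fin d))) [IsFiniteMeasure μ] (hac : μ ≪ volume)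
    (S : Finset κ) (v : κ → Fin (d+1) → ℝ) (hv : ∀ i ∈ S, v i ≠ 0) :
    ContinuousAt (FF μ S) v := by
  unfold FF
  refine continuousAt_of_dominated (bound := fun _ => 1) ?_ ?_ ?_ ?_
  · exact Filter.Eventually.of_forall fun w => (sp_meas S w).aestronglyMeasurable
  · exact Filter.Eventually.of_forall fun w => Filter.Eventually.of_forall (sp_bd S w)
  · exact integrable_const _
  · have : ∀ᵐ x ∂μ, ∀ i ∈ S, LL (v i) x ≠ 0 := by
      rw [Filter.eventually_all_finset]
      exact fun i hi => LL_null μ hac _ (hv i hi)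
    filter_upwards [this] with x hx
    unfold sp
    refine tendsto_finsetProd _ fun i hi => ?_
    have h1 : ContinuousAt (fun w : κ → Fin (d+1) → ℝ => LL (w i) x) v :=
      ((LL_cont_w x).comp (continuous_apply i)).continuousAt
    exact ContinuousAt.comp (f := fun w : κ → Fin (d+1) → ℝ => LL (w i) x)
      (sign_contAt _ (hx i hi)) h1

lemma FF_flip [DecidableEq κ] (μ : Measure (EuclideanSpace ℝ (Fin d))) (S : Finset κ)
    (v : κ → Fin (d+1) → ℝ) (c : κ) :
    FF μ S (Function.update v c (-(v c))) = (if c ∈ S then -1 else 1) * FF μ S v := by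
  unfold FF
  rw [← integral_const_mul]
  congr 1
  funext x
  unfold sp
  split_ifs with hc
  · rw [← Finset.mul_prod_erase _ _ hc, ← Finset.mul_prod_erase S _ hc]
    rw [Function.update_self, LL_neg, Real.sign_neg]
    rw [Finset.prod_congr rfl (g := fun i => Real.sign (LL (v i) x))]
    · ring
    · intro i hi
      rw [Function.update_of_ne (Finset.ne_of_mem_erase hi)]
  · rw [one_mul]
    refine Finset.prod_congr rfl fun i hi => ?_
    rw [Function.update_of_ne]
    rintro rfl; exact hc hi

/-- vanishing of all sign integrals gives an equipartition -/
lemma equi (k : ℕ) (μ : Measure (EuclideanSpace ℝ (Fin d))) [IsFiniteMeasure μ] (hac : μ ≪ volume)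
    (s : Finset (Fin k)) (v : Fin k → Fin (d+1) → ℝ) (hv : ∀ i ∈ s, v i ≠ 0)
    (h0 : ∀ S ⊆ s, S.Nonempty → FF μ S v = 0) (ε : Fin k → Bool) :
    μ (region (fun i => nv (v i)) (fun i => v i 0) s ε) = μ Set.univ / 2 ^ s.card := by
  classical
  set R := region (fun i => nv (v i)) (fun i => v i 0) s ε with hR
  let σ : Fin k → ℝ := fun i => if ε i then 1 else -1
  have hmeas : MeasurableSet R := by
    refine Finset.measurableSet_biInter _ fun i _ => ?_
    unfold halfSpace
    split_ifs
    · exact measurableSet_le measurable_const (by fun_prop)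
    · exact measurableSet_le (by fun_prop) measurable_const
  have hae : ∀ᵐ x ∂μ, R.indicator (fun _ => (1:ℝ)) x =
      (1/2) ^ s.card * ∑ S ∈ s.powerset, (∏ i ∈ S, σ i) * sp S v x := by
    have : ∀ᵐ x ∂μ, ∀ i ∈ s, LL (v i) x ≠ 0 := by
      rw [Filter.eventually_all_finset]
      exact fun i hi => LL_null μ hac _ (hv i hi)
    filter_upwards [this] with x hx
    have e1 : (1/2:ℝ) ^ s.card * ∑ S ∈ s.powerset, (∏ i ∈ S, σ i) * sp S v x =
        ∏ i ∈ s, ((1 + σ i * Real.sign (LL (v i) x)) / 2) := by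
      rw [Finset.prod_div_distrib, Finset.prod_one_add, Finset.prod_const]
      simp only [sp, Finset.prod_mul_distrib]
      rw [one_div, inv_pow]; field_simp
    rw [e1]
    have e2 : ∀ i ∈ s, (x ∈ halfSpace (nv (v i)) (v i 0) (ε i) →
        (1 + σ i * Real.sign (LL (v i) x)) / 2 = 1) ∧
        (x ∉ halfSpace (nv (v i)) (v i 0) (ε i) →
        (1 + σ i * Real.sign (LL (v i) x)) / 2 = 0) := by
      intro i hi
      have hne := hx i hi
      have hL := LL_eq (v i) x
      cases hε : ε i
      · simp only [halfSpace, σ, hε]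
        simp only [Bool.false_eq_true, if_false, Set.mem_ofPred_eq, not_le]
        constructor
        · intro h
          rw [Real.sign_of_neg (lt_of_le_of_ne (by rw [hL]; linarith) hne)]; norm_num
        · intro h
          rw [Real.sign_of_pos (by rw [hL]; linarith)]; norm_num
      · simp only [halfSpace, σ, hε]
        simp only [if_true, Set.mem_ofPred_eq, not_le]
        constructor
        · intro h
          rw [Real.sign_of_pos (lt_of_le_of_ne (by rw [hL]; linarith) hne.symm)]; norm_num
        · intro h
          rw [Real.sign_of_neg (by rw [hL]; linarith)]; norm_num
    by_cases hxR : x ∈ R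
    · rw [Set.indicator_of_mem hxR]
      symm
      refine Finset.prod_eq_one fun i hi => (e2 i hi).1 ?_
      exact Set.mem_iInter₂.1 hxR i hi
    · rw [Set.indicator_of_notMem hxR]
      symm
      have : ∃ i ∈ s, x ∉ halfSpace (nv (v i)) (v i 0) (ε i) := by
        by_contra hcon
        push Not at hcon
        exact hxR (Set.mem_iInter₂.2 hcon)
      obtain ⟨i, hi, hxi⟩ := this
      exact Finset.prod_eq_zero hi ((e2 i hi).2 hxi)
  have hIntg := integral_congr_ae hae
  rw [integral_indicator_const _ hmeas, integral_const_mul, integral_finsetSum] at hIntg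
  · rw [Finset.sum_eq_single ∅] at hIntg
    · simp only [Finset.prod_empty, one_mul, sp, integral_const, smul_eq_mul, mul_one] at hIntg
      rw [← ENNReal.toReal_eq_toReal_iff' (measure_ne_top _ _)
        (ENNReal.div_ne_top (measure_ne_top _ _) (by positivity))]
      rw [ENNReal.toReal_div]
      simp only [Measure.real] at hIntg
      rw [hIntg]
      simp [div_eq_inv_mul]
    · intro S hS hne
      rw [integral_const_mul]
      have := h0 S (Finset.mem_powerset.1 hS) (Finset.nonempty_iff_ne_empty.2 hne)
      unfold FF at this
      rw [this, mul_zero]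
    · intro h; exact absurd (Finset.empty_mem_powerset s) h
  · intro S _
    exact (sp_int μ S v).const_mul _

lemma nv_ne (μ : Measure (EuclideanSpace ℝ (Fin d))) [IsFiniteMeasure μ] (hμ : μ ≠ 0)
    (i : κ) (v : κ → Fin (d+1) → ℝ) (hv : v i ≠ 0) (h0 : FF μ {i} v = 0) : nv (v i) ≠ 0 := by
  intro hn
  have h1 : v i 0 ≠ 0 := by
    intro hz
    apply hv
    funext k
    refine Fin.cases hz (fun k => ?_) k
    have h2 : nv (v i) k = 0 := by rw [hn]; rfl
    simpa [nv] using h2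
  have h2 : ∀ x, sp {i} v x = Real.sign (-(v i 0)) := by
    intro x
    simp [sp, LL_eq, hn]
  unfold FF at h0
  simp only [h2, integral_const, smul_eq_mul, mul_eq_zero] at h0
  rcases h0 with h | h
  · rw [measureReal_eq_zero_iff] at h
    exact hμ (Measure.measure_univ_eq_zero.1 h)
  · rw [Real.sign_eq_zero_iff] at h
    exact h1 (by linarith)

end BU
end MeasurePart

noncomputable section MainPart
open Finset

namespace BU

variable {d : ℕ}

/-- replacement of zero masses -/
def fixm (μ : Measure (EuclideanSpace ℝ (Fin d))) : Measure (EuclideanSpace ℝ (Fin d)) := by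
  classical
  exact if μ = 0 then volume.restrict (Metric.ball 0 1) else μ

lemma fixm_of_ne (μ : Measure (EuclideanSpace ℝ (Fin d))) (h : μ ≠ 0) : fixm μ = μ := by
  simp [fixm, h]

lemma fixm_ne (μ : Measure (EuclideanSpace ℝ (Fin d))) : fixm μ ≠ 0 := by
  unfold fixm
  split_ifs with h
  · intro h0
    have h1 : volume.restrict (Metric.ball (0 : EuclideanSpace ℝ (Fin d)) 1) Set.univ = 0 := by
      rw [h0]; rfl
    rw [Measure.restrict_apply_univ] at h1
    exact (Metric.measure_ball_pos volume (0 : EuclideanSpace ℝ (Fin d)) one_pos).ne' h1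
  · exact h

lemma fixm_ac (μ : Measure (EuclideanSpace ℝ (Fin d))) (h : μ ≪ volume) : fixm μ ≪ volume := by
  unfold fixm
  split_ifs
  · exact Measure.absolutelyContinuous_of_le Measure.restrict_le_self
  · exact h

instance fixm_fin (μ : Measure (EuclideanSpace ℝ (Fin d))) [IsFiniteMeasure μ] :
    IsFiniteMeasure (fixm μ) := by
  unfold fixm
  split_ifs
  · exact ⟨by rw [Measure.restrict_apply_univ]; exact measure_ball_lt_top⟩
  · infer_instance

lemma equi3 {d : ℕ} (μ : Measure (EuclideanSpace ℝ (Fin d))) [IsFiniteMeasure μ]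
    (hac : μ ≪ volume)
    (s : Finset (Fin 4)) (hs : s.card = 3) (v : Fin 4 → Fin (d+1) → ℝ) (hv : ∀ i ∈ s, v i ≠ 0)
    (h0 : ∀ S ⊆ s, S.Nonempty → FF μ S v = 0) (ε : Fin 4 → Bool) :
    μ (region (fun i => nv (v i)) (fun i => v i 0) s ε) = μ Set.univ / 2 ^ 3 := by
  have h := equi 4 μ hac s v hv h0 ε
  rw [hs] at h
  exact h

open MvPolynomial in
theorem main_pos (q : ℕ) (d : ℕ) (hd : d = 7 * 2 ^ (q + 1) - 4)
    (μ : Fin (2 ^ (q + 1 + 1) - 1) → Measure (EuclideanSpace ℝ (Fin d)))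
    (hfin : ∀ r, IsFiniteMeasure (μ r))
    (hac : ∀ r, μ r ≪ volume) :
    ∃ (a : Fin 4 → EuclideanSpace ℝ (Fin d)) (b : Fin 4 → ℝ),
      (∀ i, a i ≠ 0) ∧
      (∀ r : Fin (2 ^ (q + 1 + 1) - 1), (r : ℕ) < 2 ^ (q + 1 + 1) - 2 →
        ∀ s : Finset (Fin 4), s.card = 3 → ∀ ε : Fin 4 → Bool,
          μ r (region a b s ε) = μ r Set.univ / 2 ^ 3) ∧
      (∀ r : Fin (2 ^ (q + 1 + 1) - 1), 2 ^ (q + 1 + 1) - 2 ≤ (r : ℕ) →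
        ∀ ε : Fin 4 → Bool,
          μ r (region a b ({1, 2, 3} : Finset (Fin 4)) ε) = μ r Set.univ / 2 ^ 3) := by
  have hp : 1 ≤ 2 ^ q := Nat.one_le_two_pow
  have hp1 : 2 ^ (q + 1) = 2 * 2 ^ q := by rw [pow_succ]; ring
  have hp2 : 2 ^ (q + 1 + 1) = 4 * 2 ^ q := by rw [pow_succ, pow_succ]; ring
  let m := 2 ^ (q + 1 + 1) - 2
  have hm : m + 1 = 2 ^ (q + 1 + 1) - 1 := by simp only [m]; omega
  let ρ : Fin (m + 1) → Measure (EuclideanSpace ℝ (Fin d)) := fun r => fixm (μ (Fin.cast hm r))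
  have hρ : ∀ r, IsFiniteMeasure (ρ r) := fun r => by
    have := hfin (Fin.cast hm r)
    exact fixm_fin _
  have hρac : ∀ r, ρ r ≪ volume := fun r => fixm_ac _ (hac _)
  let J := (Fin m × S14) ⊕ S7
  let ms : J → Measure (EuclideanSpace ℝ (Fin d)) := Sum.elim (fun p => ρ p.1.castSucc)
    (fun _ => ρ (Fin.last m))
  let st : J → Finset (Fin 4) := Sum.elim (fun p => p.2.1) (fun p => p.1)
  have hmsf : ∀ j, IsFiniteMeasure (ms j) := by
    rintro (j | j) <;> exact hρ _
  have hmsac : ∀ j, ms j ≪ volume := by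
    rintro (j | j) <;> exact hρac _
  obtain ⟨v, hv, hz⟩ := sphereBU (κ := Fin 4) (J := J) d (fun j v => FF (ms j) (st j) v)
    (fun j c => if c ∈ st j then 1 else 0)
    (by
      intro j v hv
      have := hmsf j
      exact (FF_contAt (ms j) (hmsac j) (st j) v (fun i _ => hv i)).continuousWithinAt)
    (by
      intro j v c _
      rw [FF_flip]
      by_cases hc : c ∈ st j <;> simp [hc])
    (mo (d, d, d - 1, d - 4))
    (by
      intro c
      fin_cases c <;> simp [mo])
    (by
      have h14 : S14.card = 14 := by decide
      have h7 : S7.card = 7 := by decide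
      simp only [J, Fintype.card_sum, Fintype.card_prod, Fintype.card_fin, Fintype.card_coe, h14, h7]
      simp only [Fin.sum_univ_four, mo]
      simp
      omega)
    (by
      have h := main_coeff q d hd
      have hprod : (∏ j : J, ∑ c, C (if c ∈ st j then (1 : ZMod 2) else 0) * X c) =
          (∏ S ∈ S7, lin S) * (∏ S ∈ S14, lin S) ^ (2 ^ (q + 2) - 2) := by
        have h1 : ∀ j : J, ∑ c, C (if c ∈ st j then (1 : ZMod 2) else 0) * X c = lin (st j) :=
          fun _ => rfl
        simp only [h1]
        rw [Fintype.prod_sum_type, mul_comm]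
        refine congrArg₂ (· * ·) ?_ ?_
        · exact Finset.prod_coe_sort S7 lin
        · rw [Fintype.prod_prod_type]
          simp only [st, Sum.elim_inl]
          rw [Finset.prod_const, Finset.card_univ, Fintype.card_fin]
          rw [← Finset.prod_coe_sort S14 lin]
      rw [hprod, h]
      exact one_ne_zero)
  have hz1 : ∀ (r : Fin m) (S : Finset (Fin 4)), S.Nonempty → S.card ≤ 3 →
      FF (ρ r.castSucc) S v = 0 := by
    intro r S hS hc
    exact hz (Sum.inl (r, ⟨S, by simp [S14, hS, hc]⟩))
  have hz2 : ∀ (S : Finset (Fin 4)), S.Nonempty → 0 ∉ S → FF (ρ (Fin.last m)) S v = 0 := by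
    intro S hS hc
    exact hz (Sum.inr ⟨S, by simp [S7, hS, hc]⟩)
  refine ⟨fun i => nv (v i), fun i => v i 0, ?_, ?_, ?_⟩
  · intro i
    have hm0 : 0 < m := by simp only [m]; omega
    have := hρ (Fin.castSucc ⟨0, hm0⟩)
    exact nv_ne (ρ (Fin.castSucc ⟨0, hm0⟩)) (fixm_ne _) i v (hv i)
      (hz1 _ _ (Finset.singleton_nonempty i) (by simp))
  · intro r hr s hs ε
    by_cases hr0 : μ r = 0
    · simp [hr0]
    · have e1 : ρ (Fin.castSucc ⟨r, hr⟩) = μ r := fixm_of_ne _ hr0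
      have := hfin r
      refine equi3 (μ r) (hac r) s hs v (fun i _ => hv i) (fun S hS hne => ?_) ε
      rw [← e1]
      exact hz1 _ _ hne (hs ▸ Finset.card_le_card hS)
  · intro r hr ε
    by_cases hr0 : μ r = 0
    · simp [hr0]
    · have e0 : Fin.cast hm (Fin.last m) = r := by
        ext
        simp only [m, Fin.val_cast, Fin.val_last]
        have := r.2
        omega
      have e1 : ρ (Fin.last m) = μ r := by
        simp only [ρ, e0]
        exact fixm_of_ne _ hr0
      have := hfin r
      have hs : ({1, 2, 3} : Finset (Fin 4)).card = 3 := by decide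
      refine equi3 (μ r) (hac r) {1, 2, 3} hs v (fun i _ => hv i) (fun S hS hne => ?_) ε
      rw [← e1]
      exact hz2 S hne (fun h => by have := hS h; revert this; decide)

end BU
end MainPart

noncomputable section HadPart
open Finset

namespace BU

/-- single sign integral -/
def HH {d : ℕ} (μ : Measure (EuclideanSpace ℝ (Fin d))) (w : Fin (d+1) → ℝ) : ℝ :=
  ∫ x, Real.sign (LL w x) ∂μ

lemma HH_eq {d : ℕ} {κ : Type} (μ : Measure (EuclideanSpace ℝ (Fin d))) (i : κ)
    (v : κ → Fin (d+1) → ℝ) : FF μ {i} v = HH μ (v i) := by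
  simp [FF, sp, HH]

lemma HH_neg {d : ℕ} (μ : Measure (EuclideanSpace ℝ (Fin d))) (w : Fin (d+1) → ℝ) :
    HH μ (-w) = - HH μ w := by
  unfold HH
  rw [← integral_neg]
  congr 1
  funext x
  rw [LL_neg, Real.sign_neg]

lemma sgn_int {d : ℕ} (μ : Measure (EuclideanSpace ℝ (Fin d))) [IsFiniteMeasure μ]
    (w : Fin (d+1) → ℝ) : Integrable (fun x => Real.sign (LL w x)) μ :=
  Integrable.of_bound (sign_meas.comp (LL_cont_x _).measurable).aestronglyMeasurable 1
    (Filter.Eventually.of_forall fun x => sign_abs_le _)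

lemma LL_smul {d : ℕ} (c : ℝ) (w : Fin (d+1) → ℝ) (x : EuclideanSpace ℝ (Fin d)) :
    LL (c • w) x = c * LL w x := by
  simp only [LL, Pi.smul_apply, smul_eq_mul, mul_sub, Finset.mul_sum, mul_assoc]

lemma sign_pos_mul (c r : ℝ) (hc : 0 < c) : Real.sign (c * r) = Real.sign r := by
  rcases lt_trichotomy r 0 with h | h | h
  · rw [Real.sign_of_neg h, Real.sign_of_neg (mul_neg_of_pos_of_neg hc h)]
  · simp [h]
  · rw [Real.sign_of_pos h, Real.sign_of_pos (mul_pos hc h)]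

lemma HH_smul {d : ℕ} (μ : Measure (EuclideanSpace ℝ (Fin d))) (c : ℝ) (hc : 0 < c)
    (w : Fin (d+1) → ℝ) : HH μ (c • w) = HH μ w := by
  unfold HH
  congr 1
  funext x
  rw [LL_smul, sign_pos_mul _ _ hc]

lemma HH_contAt {d : ℕ} (μ : Measure (EuclideanSpace ℝ (Fin d))) [IsFiniteMeasure μ]
    (hac : μ ≪ volume) (w : Fin (d+1) → ℝ) (hw : w ≠ 0) : ContinuousAt (HH μ) w := by
  have h := FF_contAt (κ := Unit) μ hac {()} (fun _ => w) (fun _ _ => hw)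
  have h2 : HH μ = (FF (κ := Unit) μ {()}) ∘ (fun w _ => w) := by
    funext w; simp [HH_eq]
  rw [h2]
  refine ContinuousAt.comp h ?_
  fun_prop

lemma sign_mono {a b : ℝ} (h : a ≤ b) : Real.sign a ≤ Real.sign b := by
  rcases lt_trichotomy a 0 with ha | ha | ha
  · rw [Real.sign_of_neg ha]
    have := abs_le.1 (sign_abs_le b)
    exact this.1
  · rw [ha, Real.sign_zero]
    rcases lt_or_eq_of_le (ha ▸ h : (0:ℝ) ≤ b) with hb | hb
    · rw [Real.sign_of_pos hb]; norm_num
    · rw [← hb, Real.sign_zero]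
  · rw [Real.sign_of_pos ha, Real.sign_of_pos (lt_of_lt_of_le ha h)]

/-- strict monotonicity of the sign integral over an open set -/
lemma HH_lt {d : ℕ} (ν : Measure (EuclideanSpace ℝ (Fin d))) [IsFiniteMeasure ν]
    [ν.IsOpenPosMeasure] (C : Set (EuclideanSpace ℝ (Fin d))) (hC : IsOpen C)
    (w w' : Fin (d+1) → ℝ) (hle : ∀ x ∈ C, LL w x ≤ LL w' x)
    (x0 : EuclideanSpace ℝ (Fin d)) (hx0 : x0 ∈ C) (h1 : LL w x0 < 0) (h2 : 0 < LL w' x0) :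
    HH (ν.restrict C) w < HH (ν.restrict C) w' := by
  unfold HH
  let g := fun x => Real.sign (LL w' x) - Real.sign (LL w x)
  have hg : Integrable g (ν.restrict C) := (sgn_int _ _).sub (sgn_int _ _)
  have hnn : 0 ≤ᵐ[ν.restrict C] g := by
    filter_upwards [ae_restrict_mem hC.measurableSet] with x hx
    exact sub_nonneg.2 (sign_mono (hle x hx))
  have hpos : 0 < ∫ x in C, g x ∂ν := by
    rw [integral_pos_iff_support_of_nonneg_ae hnn hg]
    let U := C ∩ ({x | LL w x < 0} ∩ {x | 0 < LL w' x})
    have hU : IsOpen U := hC.inter ((isOpen_lt (LL_cont_x w) continuous_const).inter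
      (isOpen_lt continuous_const (LL_cont_x w')))
    have hUpos : 0 < ν U := hU.measure_pos ν ⟨x0, hx0, h1, h2⟩
    have hsub : U ⊆ Function.support g ∩ C := by
      rintro x ⟨hx, hx1, hx2⟩
      refine ⟨?_, hx⟩
      have hx1' : LL w x < 0 := hx1
      have hx2' : 0 < LL w' x := hx2
      simp only [Function.mem_support, g]
      rw [Real.sign_of_neg hx1', Real.sign_of_pos hx2']
      norm_num
    rw [Measure.restrict_apply' hC.measurableSet]
    exact lt_of_lt_of_le hUpos (measure_mono hsub)
  have := integral_sub (sgn_int (ν.restrict C) w') (sgn_int (ν.restrict C) w)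
  have h3 : ∫ x in C, g x ∂ν = ∫ x in C, Real.sign (LL w' x) ∂ν - ∫ x in C, Real.sign (LL w x) ∂ν :=
    this
  linarith

/-- a sign integral over a nonempty open set where the function is positive -/
lemma HH_pos {d : ℕ} (ν : Measure (EuclideanSpace ℝ (Fin d))) [IsFiniteMeasure ν]
    [ν.IsOpenPosMeasure] (C : Set (EuclideanSpace ℝ (Fin d))) (hC : IsOpen C) (hne : C.Nonempty)
    (w : Fin (d+1) → ℝ) (hle : ∀ x ∈ C, 0 < LL w x) :
    HH (ν.restrict C) w ≠ 0 := by
  unfold HH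
  rw [setIntegral_congr_fun hC.measurableSet (g := fun _ => (1:ℝ))
    (fun x hx => Real.sign_of_pos (hle x hx))]
  simp only [integral_const, smul_eq_mul, mul_one]
  have := hC.measure_pos ν hne
  rw [measureReal_restrict_apply MeasurableSet.univ, Set.univ_inter]
  intro h
  rw [measureReal_eq_zero_iff] at h
  exact this.ne' h

abbrev E3 := EuclideanSpace ℝ (Fin 3)

/-- the family of planes containing the direction data -/
def PW (z θ : ℝ) (y : Fin 3 → ℝ) : Fin 4 → ℝ :=
  ![y 2 + y 1 * z, y 0 * Real.cos θ, y 0 * Real.sin θ, y 1]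

lemma LL_PW (z θ : ℝ) (y : Fin 3 → ℝ) (x : E3) :
    LL (PW z θ y) x = y 0 * (Real.cos θ * x 0 + Real.sin θ * x 1) + y 1 * (x 2 - z) - y 2 := by
  unfold LL
  rw [Fin.sum_univ_three]
  have h1 : (PW z θ y) 0 = y 2 + y 1 * z := rfl
  have h2 : (PW z θ y) (Fin.succ 0) = y 0 * Real.cos θ := rfl
  have h3 : (PW z θ y) (Fin.succ 1) = y 0 * Real.sin θ := rfl
  have h4 : (PW z θ y) (Fin.succ 2) = y 1 := rfl
  rw [h1, h2, h3, h4]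
  ring

lemma PW_ne (z θ : ℝ) (y : Fin 3 → ℝ) (hy : y ≠ 0) : PW z θ y ≠ 0 := by
  intro h
  have h1 : y 2 + y 1 * z = 0 := congrFun h 0
  have h2 : y 0 * Real.cos θ = 0 := congrFun h 1
  have h3 : y 0 * Real.sin θ = 0 := congrFun h 2
  have h4 : y 1 = 0 := congrFun h 3
  have h5 : y 0 = 0 := by
    have := Real.sin_sq_add_cos_sq θ
    have h6 : (y 0) ^ 2 = 0 := by
      linear_combination (-(y 0)^2) * this + (y 0 * Real.sin θ) * h3 + (y 0 * Real.cos θ) * h2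
    exact pow_eq_zero_iff (two_ne_zero) |>.1 h6
  apply hy
  funext i
  fin_cases i
  · exact h5
  · exact h4
  · rw [h4] at h1; simpa using h1

lemma PW_neg (z θ : ℝ) (y : Fin 3 → ℝ) : PW z θ (-y) = - PW z θ y := by
  funext i; fin_cases i <;> simp [PW] <;> ring

lemma PW_smul (z θ c : ℝ) (y : Fin 3 → ℝ) : PW z θ (c • y) = c • PW z θ y := by
  funext i; fin_cases i <;> simp [PW] <;> ring

lemma PW_cont (z : ℝ) : Continuous fun p : ℝ × (Fin 3 → ℝ) => PW z p.1 p.2 := by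
  refine continuous_pi fun i => ?_
  fin_cases i <;> simp [PW] <;> fun_prop

open MvPolynomial in
/-- ham sandwich for a linear family of affine functions -/
lemma ham {d D : ℕ} (m : Fin D → Measure (EuclideanSpace ℝ (Fin d))) (hm : ∀ j, IsFiniteMeasure (m j))
    (hac : ∀ j, m j ≪ volume) (T : (Fin (D+1) → ℝ) → Fin (d+1) → ℝ) (hT : Continuous T)
    (hT0 : ∀ y, y ≠ 0 → T y ≠ 0) (hTn : ∀ y, T (-y) = - T y) :
    ∃ y, y ≠ 0 ∧ ∀ j, HH (m j) (T y) = 0 := by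
  obtain ⟨v, hv, hz⟩ := sphereBU (κ := Unit) (J := Fin D) D (fun j v => HH (m j) (T (v ())))
    (fun _ _ => 1)
    (by
      intro j v hv
      have := hm j
      refine ContinuousAt.continuousWithinAt ?_
      refine ContinuousAt.comp (f := fun v : Unit → Fin (D+1) → ℝ => T (v ()))
        (HH_contAt (m j) (hac j) _ (hT0 _ (hv ()))) ?_
      exact (hT.comp (continuous_apply ())).continuousAt)
    (by
      intro j v c _
      have : c = () := rfl
      subst this
      rw [Function.update_self, hTn, HH_neg]
      simp)
    (Finsupp.single () D) (by intro c; simp) (by simp)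
    (by
      simp only [map_one, one_mul, Finset.univ_unique, Finset.sum_singleton, Finset.prod_const,
        Finset.card_univ, Fintype.card_fin]
      rw [show (default : Unit) = () from rfl, coeff_X_pow]
      simp)
  exact ⟨v (), hv (), hz⟩

end BU
end HadPart

noncomputable section HadPart2
open Finset

namespace BU

/-- upper open half-space -/
def Cp (z : ℝ) : Set E3 := {x | z < x 2}
/-- lower open half-space -/
def Cm (z : ℝ) : Set E3 := {x | x 2 < z}

lemma Cp_open (z : ℝ) : IsOpen (Cp z) := isOpen_lt continuous_const (by fun_prop)
lemma Cm_open (z : ℝ) : IsOpen (Cm z) := isOpen_lt (by fun_prop) continuous_const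

/-- the point with prescribed height and horizontal coordinate in direction `θ` -/
def pt (θ s h : ℝ) : E3 := WithLp.toLp 2 ![s * Real.cos θ, s * Real.sin θ, h]

lemma pt_two (θ s h : ℝ) : pt θ s h 2 = h := rfl

lemma LL_pt (z θ s h : ℝ) (y : Fin 3 → ℝ) :
    LL (PW z θ y) (pt θ s h) = y 0 * s + y 1 * (h - z) - y 2 := by
  rw [LL_PW]
  have h0 : pt θ s h 0 = s * Real.cos θ := rfl
  have h1 : pt θ s h 1 = s * Real.sin θ := rfl
  rw [h0, h1, pt_two]
  have := Real.sin_sq_add_cos_sq θ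
  linear_combination (y 0 * s) * this

/-- the plane `x 2 = z` -/
def ez (z : ℝ) : Fin 4 → ℝ := ![z, 0, 0, 1]

lemma LL_ez (z : ℝ) (x : E3) : LL (ez z) x = x 2 - z := by
  unfold LL
  rw [Fin.sum_univ_three]
  have h1 : (ez z) 0 = z := rfl
  have h2 : (ez z) (Fin.succ 0) = 0 := rfl
  have h3 : (ez z) (Fin.succ 1) = 0 := rfl
  have h4 : (ez z) (Fin.succ 2) = 1 := rfl
  rw [h1, h2, h3, h4]
  ring

lemma ez_ne (z : ℝ) : ez z ≠ 0 := by
  intro h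
  have : (1:ℝ) = 0 := congrFun h 3
  norm_num at this

/-- solutions of the bisection problem in direction `θ` -/
def Sol (ν : Measure E3) (z θ : ℝ) (y : Fin 3 → ℝ) : Prop :=
  HH (ν.restrict (Cp z)) (PW z θ y) = 0 ∧ HH (ν.restrict (Cm z)) (PW z θ y) = 0

section
variable (ν : Measure E3) [IsFiniteMeasure ν] [ν.IsOpenPosMeasure]

lemma restrict_ac (hac : ν ≪ volume) (C : Set E3) : ν.restrict C ≪ volume :=
  (Measure.absolutelyContinuous_of_le Measure.restrict_le_self).trans hac

lemma Sol_neg (z θ : ℝ) (y : Fin 3 → ℝ) (h : Sol ν z θ y) : Sol ν z θ (-y) := by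
  unfold Sol at *
  rw [PW_neg, HH_neg, HH_neg, h.1, h.2]; simp

lemma Sol_smul (z θ c : ℝ) (hc : 0 < c) (y : Fin 3 → ℝ) (h : Sol ν z θ y) : Sol ν z θ (c • y) := by
  unfold Sol at *
  rw [PW_smul, HH_smul _ _ hc, HH_smul _ _ hc]
  exact h

lemma exists_z (hac : ν ≪ volume) : ∃ z, HH ν (ez z) = 0 := by
  obtain ⟨y, hy, h⟩ := ham (d := 3) (D := 1) (fun _ => ν) (fun _ => inferInstance) (fun _ => hac)
    (fun y => ![y 0, 0, 0, y 1])
    (by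
      refine continuous_pi fun i => ?_
      fin_cases i <;> simp <;> fun_prop)
    (by
      intro y hy h
      apply hy
      funext i
      fin_cases i
      · exact congrFun h 0
      · exact congrFun h 3)
    (by
      intro y
      funext i
      fin_cases i <;> simp)
  have h := h 0
  have hne : ν ≠ 0 := by
    intro h0
    have : 0 < ν Set.univ := isOpen_univ.measure_pos ν ⟨0, trivial⟩
    rw [h0] at this
    simp at this
  have hy1 : y 1 ≠ 0 := by
    intro h1
    have := nv_ne ν hne () (fun _ => ![y 0, 0, 0, y 1]) (by
      intro h
      apply hy
      funext i
      fin_cases i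
      · exact congrFun h 0
      · exact congrFun h 3) (by rw [HH_eq]; exact h)
    apply this
    ext i
    fin_cases i <;> simp [nv, h1]
  refine ⟨y 0 / y 1, ?_⟩
  rcases lt_or_gt_of_ne hy1 with h1 | h1
  · have e : ez (y 0 / y 1) = -((-(y 1))⁻¹ • ![y 0, 0, 0, y 1]) := by
      funext i
      fin_cases i <;> simp [ez] <;> field_simp
    rw [e, HH_neg, HH_smul _ _ (by simpa using h1), h, neg_zero]
  · have e : ez (y 0 / y 1) = (y 1)⁻¹ • ![y 0, 0, 0, y 1] := by
      funext i
      fin_cases i <;> simp [ez] <;> field_simp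
    rw [e, HH_smul _ _ (by positivity), h]

lemma exists_Sol (hac : ν ≪ volume) (z θ : ℝ) : ∃ y, y ≠ 0 ∧ Sol ν z θ y := by
  obtain ⟨y, hy, h⟩ := ham (d := 3) (D := 2) ![ν.restrict (Cp z), ν.restrict (Cm z)]
    (by intro j; fin_cases j <;> simp <;> infer_instance)
    (by intro j; fin_cases j <;> simp <;> exact restrict_ac ν hac _)
    (PW z θ) ((PW_cont z).comp (by fun_prop : Continuous fun y : Fin 3 → ℝ => (θ, y)))
    (PW_ne z θ) (PW_neg z θ)
  exact ⟨y, hy, h 0, h 1⟩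

lemma Sol_ne (z θ : ℝ) (y : Fin 3 → ℝ) (hy : y ≠ 0) (h : Sol ν z θ y) : y 0 ≠ 0 := by
  intro h0
  have hLL : ∀ x, LL (PW z θ y) x = y 1 * (x 2 - z) - y 2 := by
    intro x; rw [LL_PW, h0]; ring
  have hor : y 1 ≠ 0 ∨ y 2 ≠ 0 := by
    by_contra hcon
    push Not at hcon
    apply hy
    funext i
    fin_cases i
    · exact h0
    · exact hcon.1
    · exact hcon.2
  have hp : (Cp z).Nonempty := ⟨pt 0 0 (z+1), by
    show z < pt 0 0 (z+1) 2
    rw [pt_two]; linarith⟩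
  have hm : (Cm z).Nonempty := ⟨pt 0 0 (z-1), by
    show pt 0 0 (z-1) 2 < z
    rw [pt_two]; linarith⟩
  have hneg := Sol_neg ν z θ y h
  have hLLn : ∀ x, LL (PW z θ (-y)) x = - (y 1 * (x 2 - z) - y 2) := by
    intro x; rw [PW_neg, LL_neg, hLL]
  rcases le_total 0 (y 1) with h1 | h1 <;> rcases le_total 0 (y 2) with h2 | h2
  · refine HH_pos ν (Cm z) (Cm_open z) hm (PW z θ (-y)) (fun x hx => ?_) hneg.2
    have hx : x 2 < z := hx
    rw [hLLn]
    rcases hor with hh | hh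
    · have : 0 < y 1 := lt_of_le_of_ne h1 (Ne.symm hh)
      nlinarith
    · have : 0 < y 2 := lt_of_le_of_ne h2 (Ne.symm hh)
      nlinarith
  · refine HH_pos ν (Cp z) (Cp_open z) hp (PW z θ y) (fun x hx => ?_) h.1
    have hx : z < x 2 := hx
    rw [hLL]
    rcases hor with hh | hh
    · have : 0 < y 1 := lt_of_le_of_ne h1 (Ne.symm hh)
      nlinarith
    · have : y 2 < 0 := lt_of_le_of_ne h2 hh
      nlinarith
  · refine HH_pos ν (Cp z) (Cp_open z) hp (PW z θ (-y)) (fun x hx => ?_) hneg.1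
    have hx : z < x 2 := hx
    rw [hLLn]
    rcases hor with hh | hh
    · have : y 1 < 0 := lt_of_le_of_ne h1 hh
      nlinarith
    · have : 0 < y 2 := lt_of_le_of_ne h2 (Ne.symm hh)
      nlinarith
  · refine HH_pos ν (Cm z) (Cm_open z) hm (PW z θ y) (fun x hx => ?_) h.2
    have hx : x 2 < z := hx
    rw [hLL]
    rcases hor with hh | hh
    · have : y 1 < 0 := lt_of_le_of_ne h1 hh
      nlinarith
    · have : y 2 < 0 := lt_of_le_of_ne h2 hh
      nlinarith

/-- comparison of two solutions over an open half-space -/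
lemma Sol_cmp (z θ h : ℝ) (C : Set E3) (hC : IsOpen C) (hh : ∀ s, pt θ s h ∈ C)
    (y y' : Fin 3 → ℝ) (hy : y 0 = 1) (hy' : y' 0 = 1)
    (hlt : ∀ x ∈ C, (y 1) * (x 2 - z) - y 2 < y' 1 * (x 2 - z) - y' 2) :
    HH (ν.restrict C) (PW z θ y) < HH (ν.restrict C) (PW z θ y') := by
  let a := (y 1) * (h - z) - y 2
  let b := (y' 1) * (h - z) - y' 2
  have hab : a < b := by
    have := hlt _ (hh 0)
    rw [pt_two] at this
    exact this
  refine HH_lt ν C hC _ _ (fun x hx => ?_) (pt θ (-(a + b)/2) h) (hh _) ?_ ?_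
  · rw [LL_PW, LL_PW, hy, hy']
    have := hlt x hx
    linarith
  · rw [LL_pt, hy]
    simp only [a, b] at *
    linarith
  · rw [LL_pt, hy']
    simp only [a, b] at *
    linarith

lemma Sol_unique1 (z θ : ℝ) (y y' : Fin 3 → ℝ) (hy : y 0 = 1) (hy' : y' 0 = 1)
    (h : Sol ν z θ y) (h' : Sol ν z θ y') : y = y' := by
  by_contra hne
  have hor : y' 1 - y 1 ≠ 0 ∨ y' 2 - y 2 ≠ 0 := by
    by_contra hcon
    push Not at hcon
    apply hne
    funext i
    fin_cases i
    · exact hy.trans hy'.symm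
    · show y 1 = y' 1
      linarith [hcon.1]
    · show y 2 = y' 2
      linarith [hcon.2]
  have hp : ∀ s, pt θ s (z+1) ∈ Cp z := fun s => by
    show z < pt θ s (z+1) 2
    rw [pt_two]; linarith
  have hm : ∀ s, pt θ s (z-1) ∈ Cm z := fun s => by
    show pt θ s (z-1) 2 < z
    rw [pt_two]; linarith
  rcases le_total 0 (y' 1 - y 1) with h1 | h1 <;> rcases le_total 0 (y' 2 - y 2) with h2 | h2
  · have := Sol_cmp ν z θ (z-1) (Cm z) (Cm_open z) hm y' y hy' hy (fun x hx => by
      have hx : x 2 < z := hx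
      rcases hor with hh | hh
      · have : 0 < y' 1 - y 1 := lt_of_le_of_ne h1 (Ne.symm hh)
        nlinarith
      · have : 0 < y' 2 - y 2 := lt_of_le_of_ne h2 (Ne.symm hh)
        nlinarith)
    rw [h.2, h'.2] at this
    exact lt_irrefl _ this
  · have := Sol_cmp ν z θ (z+1) (Cp z) (Cp_open z) hp y y' hy hy' (fun x hx => by
      have hx : z < x 2 := hx
      rcases hor with hh | hh
      · have : 0 < y' 1 - y 1 := lt_of_le_of_ne h1 (Ne.symm hh)
        nlinarith
      · have : y' 2 - y 2 < 0 := lt_of_le_of_ne h2 hh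
        nlinarith)
    rw [h.1, h'.1] at this
    exact lt_irrefl _ this
  · have := Sol_cmp ν z θ (z+1) (Cp z) (Cp_open z) hp y' y hy' hy (fun x hx => by
      have hx : z < x 2 := hx
      rcases hor with hh | hh
      · have : y' 1 - y 1 < 0 := lt_of_le_of_ne h1 hh
        nlinarith
      · have : 0 < y' 2 - y 2 := lt_of_le_of_ne h2 (Ne.symm hh)
        nlinarith)
    rw [h.1, h'.1] at this
    exact lt_irrefl _ this
  · have := Sol_cmp ν z θ (z-1) (Cm z) (Cm_open z) hm y y' hy hy' (fun x hx => by
      have hx : x 2 < z := hx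
      rcases hor with hh | hh
      · have : y' 1 - y 1 < 0 := lt_of_le_of_ne h1 hh
        nlinarith
      · have : y' 2 - y 2 < 0 := lt_of_le_of_ne h2 hh
        nlinarith)
    rw [h.2, h'.2] at this
    exact lt_irrefl _ this

lemma Sol_unique (z θ : ℝ) (y y' : Fin 3 → ℝ) (hy : 0 < y 0) (hy' : 0 < y' 0)
    (hn : ‖y‖ = 1) (hn' : ‖y'‖ = 1)
    (h : Sol ν z θ y) (h' : Sol ν z θ y') : y = y' := by
  have e := Sol_unique1 ν z θ ((y 0)⁻¹ • y) ((y' 0)⁻¹ • y') (by simp [hy.ne'])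
    (by simp [hy'.ne']) (Sol_smul ν z θ _ (by positivity) y h)
    (Sol_smul ν z θ _ (by positivity) y' h')
  have e2 := congrArg norm e
  rw [norm_smul, norm_smul, hn, hn', mul_one, mul_one, Real.norm_of_nonneg (by positivity),
    Real.norm_of_nonneg (by positivity), inv_inj] at e2
  rw [e2] at e
  exact smul_right_injective _ (inv_ne_zero hy'.ne') e

lemma exists_loop (hac : ν ≪ volume) (z : ℝ) : ∃ N : ℝ → Fin 3 → ℝ, Continuous N ∧
    (∀ θ, 0 < N θ 0 ∧ ‖N θ‖ = 1 ∧ Sol ν z θ (N θ)) := by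
  have hex : ∀ θ, ∃ y : Fin 3 → ℝ, 0 < y 0 ∧ ‖y‖ = 1 ∧ Sol ν z θ y := by
    intro θ
    obtain ⟨y, hy, h⟩ := exists_Sol ν hac z θ
    have hy0 := Sol_ne ν z θ y hy h
    have hn : 0 < ‖y‖ := norm_pos_iff.2 hy
    rcases lt_or_gt_of_ne hy0 with h0 | h0
    · refine ⟨‖y‖⁻¹ • (-y), ?_, ?_, Sol_smul ν z θ _ (by positivity) _ (Sol_neg ν z θ y h)⟩
      · simp only [Pi.smul_apply, Pi.neg_apply, smul_eq_mul]
        have : 0 < - y 0 := by linarith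
        positivity
      · rw [norm_smul, norm_neg, norm_inv, norm_norm, inv_mul_cancel₀ hn.ne']
    · refine ⟨‖y‖⁻¹ • y, ?_, ?_, Sol_smul ν z θ _ (by positivity) _ h⟩
      · simp only [Pi.smul_apply, smul_eq_mul]
        positivity
      · rw [norm_smul, norm_inv, norm_norm, inv_mul_cancel₀ hn.ne']
  choose N hN using hex
  refine ⟨N, ?_, hN⟩
  rw [continuous_iff_continuousAt]
  intro θ0
  refine (isCompact_sphere (0 : Fin 3 → ℝ) 1).tendsto_nhds_of_unique_mapClusterPt
    (Filter.Eventually.of_forall fun θ => by simpa using (hN θ).2.1) ?_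
  intro y hy hcl
  have hy1 : ‖y‖ = 1 := by simpa using hy
  have hyne : y ≠ 0 := by
    rw [← norm_pos_iff, hy1]; norm_num
  have key : ∀ C : Set E3, (∀ θ, HH (ν.restrict C) (PW z θ (N θ)) = 0) →
      HH (ν.restrict C) (PW z θ0 y) = 0 := by
    intro C hC
    by_contra hne
    have hcont : ContinuousAt (fun p : ℝ × (Fin 3 → ℝ) => HH (ν.restrict C) (PW z p.1 p.2)) (θ0, y) :=
      ContinuousAt.comp (f := fun p : ℝ × (Fin 3 → ℝ) => PW z p.1 p.2)
        (HH_contAt _ (restrict_ac ν hac C) _ (PW_ne z θ0 y hyne)) (PW_cont z).continuousAt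
    have hev := hcont.eventually_ne hne
    rw [nhds_prod_eq, Filter.eventually_prod_iff] at hev
    obtain ⟨P, hP, Q, hQ, hPQ⟩ := hev
    have hfr := hcl.frequently hQ
    obtain ⟨θ, h1, h2⟩ := (hfr.and_eventually hP).exists
    exact hPQ h2 h1 (hC θ)
  have hSol : Sol ν z θ0 y := ⟨key _ fun θ => (hN θ).2.2.1, key _ fun θ => (hN θ).2.2.2⟩
  have hy0 : 0 ≤ y 0 := by
    by_contra hlt
    push Not at hlt
    have hQ : ∀ᶠ w : Fin 3 → ℝ in nhds y, w 0 < 0 :=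
      (continuous_apply 0).continuousAt.eventually_lt continuousAt_const hlt
    obtain ⟨θ, h1⟩ := (hcl.frequently hQ).exists
    have := (hN θ).1
    linarith
  have hy0' : 0 < y 0 := lt_of_le_of_ne hy0 (Ne.symm (Sol_ne ν z θ0 y hyne hSol))
  exact Sol_unique ν z θ0 y (N θ0) hy0' (hN θ0).1 hy1 (hN θ0).2.1 hSol (hN θ0).2.2

/-- the antiperiodic loop of bisecting planes -/
lemma exists_W (hac : ν ≪ volume) (z : ℝ) : ∃ W : ℝ → Fin 4 → ℝ, Continuous W ∧ (∀ θ, W θ ≠ 0) ∧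
    (∀ θ, W (θ + Real.pi) = - W θ) ∧ (∀ θ, HH (ν.restrict (Cp z)) (W θ) = 0) ∧
    (∀ θ, HH (ν.restrict (Cm z)) (W θ) = 0) := by
  obtain ⟨N, hc, hN⟩ := exists_loop ν hac z
  refine ⟨fun θ => PW z θ (N θ), (PW_cont z).comp (continuous_id.prodMk hc), ?_, ?_, ?_, ?_⟩
  · intro θ
    apply PW_ne
    rw [← norm_pos_iff, (hN θ).2.1]; norm_num
  · intro θ
    have e1 : ∀ y : Fin 3 → ℝ, PW z (θ + Real.pi) ![y 0, -y 1, -y 2] = - PW z θ y := by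
      intro y
      funext i
      fin_cases i <;> simp [PW] <;> ring
    have e2 : N (θ + Real.pi) = ![N θ 0, -N θ 1, -N θ 2] := by
      refine Sol_unique ν z (θ + Real.pi) _ _ (hN _).1 (hN θ).1 (hN _).2.1 ?_ (hN _).2.2 ?_
      · rw [← (hN θ).2.1]
        simp only [Pi.norm_def]
        congr 1
        refine Finset.sup_congr rfl fun i _ => ?_
        fin_cases i <;> simp
      · unfold Sol
        rw [e1, HH_neg, HH_neg, (hN θ).2.2.1, (hN θ).2.2.2]; simp
    show PW z (θ + Real.pi) (N (θ + Real.pi)) = - PW z θ (N θ)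
    rw [e2, e1]
  · exact fun θ => (hN θ).2.2.1
  · exact fun θ => (hN θ).2.2.2

end

end BU
end HadPart2

noncomputable section HadPart3
open Finset

namespace BU

/-- configuration of planes -/
def VV (z : ℝ) (w w' : Fin 4 → ℝ) : Fin 4 → Fin 4 → ℝ := ![ez z, ez z, w, w']

/-- the two index sets to be killed -/
def TT (j : ℕ) : Finset (Fin 4) := if j = 0 then {2, 3} else {1, 2, 3}

/-- extra sign factor -/
def hx (z : ℝ) (j : ℕ) (x : E3) : ℝ := if j = 0 then 1 else Real.sign (LL (ez z) x)

lemma sp_TT (z : ℝ) (w w' : Fin 4 → ℝ) (j : ℕ) (x : E3) :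
    sp (TT j) (VV z w w') x = hx z j x * (Real.sign (LL w x) * Real.sign (LL w' x)) := by
  unfold sp TT hx
  split_ifs with h
  · rw [Finset.prod_pair (by decide)]
    simp [VV]
  · rw [Finset.prod_insert (by decide), Finset.prod_pair (by decide)]
    simp [VV]

/-- the remaining obstruction -/
def QQ (ν : Measure E3) (z : ℝ) (j : ℕ) (w w' : Fin 4 → ℝ) : ℝ := FF ν (TT j) (VV z w w')

lemma QQ_eq (ν : Measure E3) (z : ℝ) (j : ℕ) (w w' : Fin 4 → ℝ) :
    QQ ν z j w w' = ∫ x, hx z j x * (Real.sign (LL w x) * Real.sign (LL w' x)) ∂ν := by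
  unfold QQ FF
  simp only [sp_TT]

lemma QQ_symm (ν : Measure E3) (z : ℝ) (j : ℕ) (w w' : Fin 4 → ℝ) :
    QQ ν z j w w' = QQ ν z j w' w := by
  rw [QQ_eq, QQ_eq]
  congr 1; funext x; ring

lemma QQ_neg (ν : Measure E3) (z : ℝ) (j : ℕ) (w w' : Fin 4 → ℝ) :
    QQ ν z j w (-w') = - QQ ν z j w w' := by
  rw [QQ_eq, QQ_eq, ← integral_neg]
  congr 1; funext x
  rw [LL_neg, Real.sign_neg]; ring

lemma sign_sq (r : ℝ) (h : r ≠ 0) : Real.sign r * Real.sign r = 1 := by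
  rcases lt_or_gt_of_ne h with h | h
  · rw [Real.sign_of_neg h]; norm_num
  · rw [Real.sign_of_pos h]; norm_num

lemma QQ_diag (ν : Measure E3) (hac : ν ≪ volume) (z : ℝ) (j : ℕ) (w : Fin 4 → ℝ) (hw : w ≠ 0) :
    QQ ν z j w w = ∫ x, hx z j x ∂ν := by
  rw [QQ_eq]
  refine integral_congr_ae ?_
  filter_upwards [LL_null ν hac w hw] with x hx
  rw [sign_sq _ hx, mul_one]

lemma int_split (ν : Measure E3) [IsFiniteMeasure ν] (hac : ν ≪ volume) (z : ℝ) (g : E3 → ℝ)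
    (hg : Integrable g ν) : ∫ x, g x ∂ν = ∫ x in Cp z, g x ∂ν + ∫ x in Cm z, g x ∂ν := by
  rw [← setIntegral_union (μ := ν) (f := g) ?_ (Cm_open z).measurableSet hg.integrableOn hg.integrableOn]
  · rw [← setIntegral_univ]
    refine setIntegral_congr_set ?_
    rw [ae_eq_set]
    constructor
    · refine measure_mono_null ?_ (ae_iff.1 (LL_null ν hac (ez z) (ez_ne z)))
      intro x hx
      simp only [Set.mem_ofPred_eq, not_not]
      rw [LL_ez]
      have h1 : ¬ (x ∈ Cp z ∪ Cm z) := hx.2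
      have h2 : ¬ (z < x 2) := fun h => h1 (Or.inl h)
      have h3 : ¬ (x 2 < z) := fun h => h1 (Or.inr h)
      linarith [le_antisymm (not_lt.1 h2) (not_lt.1 h3)]
    · simp
  · rw [Set.disjoint_left]
    intro x h1 h2
    exact lt_asymm (show z < x 2 from h1) h2

lemma HH_of (ν : Measure E3) [IsFiniteMeasure ν] (hac : ν ≪ volume) (z : ℝ) (w : Fin 4 → ℝ)
    (h1 : HH (ν.restrict (Cp z)) w = 0) (h2 : HH (ν.restrict (Cm z)) w = 0) : HH ν w = 0 := by
  unfold HH at *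
  rw [int_split ν hac z _ (sgn_int ν w), h1, h2, add_zero]

lemma HH_of2 (ν : Measure E3) [IsFiniteMeasure ν] (hac : ν ≪ volume) (z : ℝ) (w : Fin 4 → ℝ)
    (h1 : HH (ν.restrict (Cp z)) w = 0) (h2 : HH (ν.restrict (Cm z)) w = 0) :
    ∫ x, Real.sign (LL (ez z) x) * Real.sign (LL w x) ∂ν = 0 := by
  unfold HH at *
  have hi : Integrable (fun x => Real.sign (LL (ez z) x) * Real.sign (LL w x)) ν := by
    refine Integrable.of_bound (((sign_meas.comp (LL_cont_x _).measurable).mul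
      (sign_meas.comp (LL_cont_x _).measurable))).aestronglyMeasurable 1
      (Filter.Eventually.of_forall fun x => ?_)
    rw [Real.norm_eq_abs, abs_mul]
    exact mul_le_one₀ (sign_abs_le _) (abs_nonneg _) (sign_abs_le _)
  rw [int_split ν hac z _ hi]
  have e1 : ∫ x in Cp z, Real.sign (LL (ez z) x) * Real.sign (LL w x) ∂ν = 0 := by
    rw [← h1]
    refine setIntegral_congr_fun (Cp_open z).measurableSet fun x hx => ?_
    have : 0 < LL (ez z) x := by rw [LL_ez]; exact sub_pos.2 hx
    simp [Real.sign_of_pos this]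
  have e2 : ∫ x in Cm z, Real.sign (LL (ez z) x) * Real.sign (LL w x) ∂ν = 0 := by
    rw [← neg_zero, ← h2, ← integral_neg]
    refine setIntegral_congr_fun (Cm_open z).measurableSet fun x hx => ?_
    have : LL (ez z) x < 0 := by rw [LL_ez]; exact sub_neg.2 hx
    simp [Real.sign_of_neg this]
  rw [e1, e2, add_zero]

lemma sets_cases : ∀ S : Finset (Fin 4), S.Nonempty → 0 ∉ S → S = {1} ∨ S = {2} ∨ S = {3} ∨
    S = {1, 2} ∨ S = {1, 3} ∨ S = {2, 3} ∨ S = {1, 2, 3} := by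
  decide

lemma had_full (ν : Measure E3) [IsFiniteMeasure ν] [ν.IsOpenPosMeasure] (hac : ν ≪ volume) :
    ∃ v : Fin 4 → Fin 4 → ℝ, (∀ i, v i ≠ 0) ∧ ∀ S : Finset (Fin 4), S.Nonempty → 0 ∉ S →
      FF ν S v = 0 := by
  obtain ⟨z, hz⟩ := exists_z ν hac
  obtain ⟨W, hWc, hW0, hWp, hW1, hW2⟩ := exists_W ν hac z
  have hVne : ∀ s t i, VV z (W s) (W t) i ≠ 0 := by
    intro s t i
    fin_cases i
    · exact ez_ne z
    · exact ez_ne z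
    · exact hW0 s
    · exact hW0 t
  let sf : (Fin 2 → ℝ) → ℝ := fun x => Real.pi * (x 0 - x 1) / 2
  let tf : (Fin 2 → ℝ) → ℝ := fun x => Real.pi * (x 0 + x 1) / 2
  obtain ⟨x, hx⟩ := cubeBU (κ := Unit) (ι := Fin 2) 2 (fun _ => ()) (fun i => i.val)
    (fun i i' _ h => Fin.ext h) (by simp)
    (fun j x => QQ ν z j (W (sf x)) (W (tf x))) (fun _ _ => 1)
    (by
      intro j
      rw [continuous_iff_continuousAt]
      intro x
      have h := FF_contAt ν hac (TT j) (VV z (W (sf x)) (W (tf x))) (fun i _ => hVne _ _ i)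
      refine ContinuousAt.comp (f := fun x => VV z (W (sf x)) (W (tf x))) h ?_
      refine Continuous.continuousAt ?_
      have hs : Continuous sf := by fun_prop
      have ht : Continuous tf := by fun_prop
      refine continuous_pi fun i => ?_
      fin_cases i
      · exact continuous_const
      · exact continuous_const
      · exact hWc.comp hs
      · exact hWc.comp ht)
    (by
      intro j x i i' y hxi _ hlt
      have hi : i = 1 := by
        have := i.2; have := i'.2
        exact Fin.ext (show i.val = 1 by omega)
      have hi' : i' = 0 := by
        have := i.2; have := i'.2
        exact Fin.ext (show i'.val = 0 by omega)
      subst hi hi'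
      have key : ∀ x : Fin 2 → ℝ, (x 1 = 0 → QQ ν z j (W (sf x)) (W (tf x)) = ∫ x, BU.hx z j x ∂ν) ∧
          (x 1 = 1 → QQ ν z j (W (sf x)) (W (tf x)) = - ∫ x, BU.hx z j x ∂ν) := by
        intro x
        constructor
        · intro h
          have : tf x = sf x := by simp [tf, sf, h]
          rw [this, QQ_diag ν hac _ _ _ (hW0 _)]
        · intro h
          have : tf x = sf x + Real.pi := by simp only [tf, sf, h]; ring
          rw [this, hWp, QQ_neg, QQ_diag ν hac _ _ _ (hW0 _)]
      have hu : Function.update x 0 y 1 = x 1 := by simp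
      rcases hxi with h | h
      · rw [(key x).1 h, (key _).1 (hu.trans h)]
      · rw [(key x).2 h, (key _).2 (hu.trans h)])
    (by
      intro j x i hmin hxi
      have hi : i = 0 := by
        have := hmin 0 rfl
        exact Fin.ext (by simpa using this)
      subst hi
      have e1 : sf (fun a => 1 - x a) = tf x := by
        simp only [sf, tf, hxi]; ring
      have e2 : tf (fun a => 1 - x a) = sf x + Real.pi := by
        simp only [sf, tf, hxi]; ring
      simp only [if_true, e1, e2, hWp, QQ_neg]
      rw [QQ_symm]
      simp)
    (Finsupp.single () 2)
    (by intro c; simp)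
    (by
      simp [MvPolynomial.X_pow_eq_monomial])
  refine ⟨VV z (W (sf x)) (W (tf x)), hVne _ _, ?_⟩
  intro S hS h0
  rcases sets_cases S hS h0 with rfl | rfl | rfl | rfl | rfl | rfl | rfl
  · rw [HH_eq]; exact hz
  · rw [HH_eq]; exact HH_of ν hac z _ (hW1 _) (hW2 _)
  · rw [HH_eq]; exact HH_of ν hac z _ (hW1 _) (hW2 _)
  · rw [← HH_of2 ν hac z _ (hW1 (sf x)) (hW2 _)]
    unfold FF sp
    congr 1; funext y
    rw [Finset.prod_pair (by decide)]; rfl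
  · rw [← HH_of2 ν hac z _ (hW1 (tf x)) (hW2 _)]
    unfold FF sp
    congr 1; funext y
    rw [Finset.prod_pair (by decide)]; rfl
  · exact hx 0 (by norm_num)
  · exact hx 1 (by norm_num)

lemma had_gen (μ : Measure E3) [IsFiniteMeasure μ] (hac : μ ≪ volume) :
    ∃ v : Fin 4 → Fin 4 → ℝ, (∀ i, v i ≠ 0) ∧ ∀ S : Finset (Fin 4), S.Nonempty → 0 ∉ S →
      FF μ S v = 0 := by
  obtain ⟨ρ, hρf, hvρ, hρv⟩ := exists_isFiniteMeasure_absolutelyContinuous (volume : Measure E3)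
  let K : Set (Fin 4 → Fin 4 → ℝ) := {v | ∀ i, ‖v i‖ = 1}
  have hKne : ∀ v ∈ K, ∀ i, v i ≠ 0 := by
    intro v hv i h
    have := hv i
    rw [h, norm_zero] at this
    norm_num at this
  have hK : IsCompact K := by
    have : K = Set.pi Set.univ fun _ : Fin 4 => Metric.sphere (0 : Fin 4 → ℝ) 1 := by
      ext v; simp [K]
    rw [this]
    exact isCompact_univ_pi fun _ => isCompact_sphere _ _
  let Φ : (Fin 4 → Fin 4 → ℝ) → ℝ := fun v => ∑ S ∈ S7, |FF μ S v|
  have hΦ : ContinuousOn Φ K := by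
    refine continuousOn_finsetSum _ fun S _ => ?_
    intro v hv
    exact ((FF_contAt μ hac S v fun i _ => hKne v hv i).abs).continuousWithinAt
  have happ : ∀ ε : ℝ, 0 < ε → ∃ v ∈ K, Φ v ≤ S7.card * (ε * ρ.real Set.univ) := by
    intro ε hε
    let ν : Measure E3 := μ + (ENNReal.ofReal ε) • ρ
    have hc : ENNReal.ofReal ε ≠ 0 := by simpa using hε
    have hsm : IsFiniteMeasure ((ENNReal.ofReal ε) • ρ) := Measure.smul_finite ρ ENNReal.ofReal_ne_top
    have hνf : IsFiniteMeasure ν := inferInstanceAs (IsFiniteMeasure (μ + (ENNReal.ofReal ε) • ρ))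
    have hνac : ν ≪ volume := by
      intro s hs
      simp [ν, hac hs, hρv hs]
    have hνo : ν.IsOpenPosMeasure := by
      refine Measure.AbsolutelyContinuous.isOpenPosMeasure (μ := (volume : Measure E3)) ?_
      intro s hs
      have h1 : ENNReal.ofReal ε * ρ s = 0 := by
        have : μ s + ENNReal.ofReal ε * ρ s = 0 := hs
        exact (add_eq_zero.1 this).2
      exact hvρ ((mul_eq_zero.1 h1).resolve_left hc)
    obtain ⟨v, hv, h0⟩ := had_full ν hνac
    let u : Fin 4 → Fin 4 → ℝ := fun i => ‖v i‖⁻¹ • v i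
    have hu : u ∈ K := by
      intro i
      rw [norm_smul, norm_inv, norm_norm, inv_mul_cancel₀ (norm_ne_zero_iff.2 (hv i))]
    have hsp : ∀ S x, sp S u x = sp S v x := by
      intro S x
      unfold sp
      refine Finset.prod_congr rfl fun i _ => ?_
      rw [LL_smul, sign_pos_mul _ _ (inv_pos.2 (norm_pos_iff.2 (hv i)))]
    refine ⟨u, hu, ?_⟩
    rw [← nsmul_eq_mul]
    refine Finset.sum_le_card_nsmul _ _ _ fun S hS => ?_
    have hS' : S.Nonempty ∧ 0 ∉ S := by simpa [S7] using hS
    have h1 : FF ν S u = 0 := by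
      rw [← h0 S hS'.1 hS'.2]
      unfold FF
      simp only [hsp]
    have h2 : FF ν S u = FF μ S u + ε * FF ρ S u := by
      unfold FF
      rw [integral_add_measure (sp_int μ S u) (sp_int _ S u), integral_smul_measure,
        ENNReal.toReal_ofReal hε.le, smul_eq_mul]
    have h3 : |FF ρ S u| ≤ ρ.real Set.univ := by
      have := norm_integral_le_of_norm_le_const (μ := ρ) (Filter.Eventually.of_forall (sp_bd S u))
      rw [one_mul] at this
      exact this
    have h4 : FF μ S u = - (ε * FF ρ S u) := by linarith
    rw [h4, abs_neg, abs_mul, abs_of_pos hε]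
    exact mul_le_mul_of_nonneg_left h3 hε.le
  have hne : K.Nonempty := by
    obtain ⟨v, hv, _⟩ := happ 1 one_pos
    exact ⟨v, hv⟩
  obtain ⟨v, hv, hmin⟩ := hK.exists_isMinOn hne hΦ
  have hnn : 0 ≤ Φ v := Finset.sum_nonneg fun _ _ => abs_nonneg _
  have hz : Φ v = 0 := by
    refine le_antisymm ?_ hnn
    by_contra hcon
    push Not at hcon
    let C := (S7.card : ℝ) * ρ.real Set.univ
    have hC : 0 ≤ C := by positivity
    obtain ⟨u, hu, hle⟩ := happ (Φ v / (2 * (C + 1))) (by positivity)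
    have h1 : Φ v ≤ Φ u := hmin hu
    have h2 : Φ v ≤ Φ v / (2 * (C + 1)) * C := by
      calc Φ v ≤ _ := h1.trans hle
        _ = _ := by simp only [C]; ring
    rw [div_mul_eq_mul_div, le_div_iff₀ (by positivity)] at h2
    nlinarith
  refine ⟨v, hKne v hv, ?_⟩
  intro S hS h0
  have := (Finset.sum_eq_zero_iff_of_nonneg (fun _ _ => abs_nonneg _)).1 hz S (by simp [S7, hS, h0])
  exact abs_eq_zero.1 this

theorem main_zero (d : ℕ) (hd : d = 7 * 2 ^ 0 - 4)
    (μ : Fin (2 ^ (0 + 1) - 1) → Measure (EuclideanSpace ℝ (Fin d)))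
    (hfin : ∀ r, IsFiniteMeasure (μ r))
    (hac : ∀ r, μ r ≪ volume) :
    ∃ (a : Fin 4 → EuclideanSpace ℝ (Fin d)) (b : Fin 4 → ℝ),
      (∀ i, a i ≠ 0) ∧
      (∀ r : Fin (2 ^ (0 + 1) - 1), (r : ℕ) < 2 ^ (0 + 1) - 2 →
        ∀ s : Finset (Fin 4), s.card = 3 → ∀ ε : Fin 4 → Bool,
          μ r (region a b s ε) = μ r Set.univ / 2 ^ 3) ∧
      (∀ r : Fin (2 ^ (0 + 1) - 1), 2 ^ (0 + 1) - 2 ≤ (r : ℕ) →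
        ∀ ε : Fin 4 → Bool,
          μ r (region a b ({1, 2, 3} : Finset (Fin 4)) ε) = μ r Set.univ / 2 ^ 3) := by
  have hd3 : d = 3 := by simpa using hd
  clear hd
  subst hd3
  let r0 : Fin (2 ^ (0 + 1) - 1) := ⟨0, by norm_num⟩
  have hr : ∀ r, r = r0 := by
    intro r
    apply Fin.ext
    have := r.2
    simp only [r0]
    norm_num at this ⊢
  let m : Measure E3 := fixm (μ r0)
  have := hfin r0
  have hmf : IsFiniteMeasure m := fixm_fin _
  have hmac : m ≪ volume := fixm_ac _ (hac r0)
  obtain ⟨v, hv, h0⟩ := had_gen m hmac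
  let u : Fin 4 → Fin 4 → ℝ := Function.update v 0 (ez 0)
  have huv : ∀ S : Finset (Fin 4), S.Nonempty → 0 ∉ S → FF m S u = 0 := by
    intro S hS hn
    rw [← h0 S hS hn]
    unfold FF sp
    congr 1; funext x
    refine Finset.prod_congr rfl fun i hi => ?_
    have : i ≠ 0 := by rintro rfl; exact hn hi
    simp [u, Function.update_of_ne this]
  have hu : ∀ i, u i ≠ 0 := by
    intro i
    by_cases hi : i = 0
    · subst hi; simpa [u] using ez_ne 0
    · simpa [u, Function.update_of_ne hi] using hv i
  refine ⟨fun i => nv (u i), fun i => u i 0, ?_, ?_, ?_⟩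
  · intro i
    by_cases hi : i = 0
    · subst hi
      intro h
      have h2 : nv (u 0) 2 = 0 := by
        have h3 : nv (u 0) = 0 := h
        rw [h3]; rfl
      have h4 : nv (u 0) 2 = 1 := by
        simp only [u, Function.update_self]
        rfl
      rw [h4] at h2
      norm_num at h2
    · exact nv_ne m (fixm_ne _) i u (hu i) (huv _ (Finset.singleton_nonempty i)
        (by simpa using fun h => hi h.symm))
  · intro r h
    exact absurd h (by simp)
  · intro r _ ε
    rw [hr r]
    by_cases hz : μ r0 = 0
    · simp [hz]
    · have e1 : m = μ r0 := fixm_of_ne _ hz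
      refine equi3 (μ r0) (hac r0) {1, 2, 3} (by decide) u (fun i _ => hu i) (fun S hS hne => ?_) ε
      rw [← e1]
      exact huv S hne (fun h => by have := hS h; revert this; decide)

end BU
end HadPart3

theorem stmt_10 (q : ℕ) (d : ℕ) (hd : d = 7 * 2 ^ q - 4)
    (μ : Fin (2 ^ (q + 1) - 1) → Measure (EuclideanSpace ℝ (Fin d)))
    (hfin : ∀ r, IsFiniteMeasure (μ r))
    (hac : ∀ r, μ r ≪ volume) :
    ∃ (a : Fin 4 → EuclideanSpace ℝ (Fin d)) (b : Fin 4 → ℝ),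
      (∀ i, a i ≠ 0) ∧
      -- each of the first 2^(q+1) - 2 masses is equipartitioned by any three of the four
      (∀ r : Fin (2 ^ (q + 1) - 1), (r : ℕ) < 2 ^ (q + 1) - 2 →
        ∀ s : Finset (Fin 4), s.card = 3 → ∀ ε : Fin 4 → Bool,
          μ r (region a b s ε) = μ r Set.univ / 2 ^ 3) ∧
      -- the remaining mass is equipartitioned by H₂, H₃, H₄
      (∀ r : Fin (2 ^ (q + 1) - 1), 2 ^ (q + 1) - 2 ≤ (r : ℕ) →
        ∀ ε : Fin 4 → Bool,
          μ r (region a b ({1, 2, 3} : Finset (Fin 4)) ε) = μ r Set.univ / 2 ^ 3) := by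
  rcases q with _ | q
  · exact BU.main_zero d hd μ hfin hac
  · exact BU.main_pos q d hd μ hfin hac
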